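/- arXiv:1707.05008 — 8 statements merged into one kernel-verified Lean document; each statement's English description precedes it below -/
import Mathlib

section
/- Let n ≥ 2 be an integer and ζ_n ∈ ℂ a primitive n-th root of unity. For every complex number x with 0 < |x| < min_{0<m<n} |1 − ζ_n^m|, the series ∑_{k=1}^∞ z_n(k;ζ_n)·(x/(1−ζ_n))^k converges absolutely and its sum equals n·x/(1 − (1+x)^n) + 1 (in particular (1+x)^n ≠ 1 for such x). -/
/-- The `q`-integer `[m]_q = (1 - q^m)/(1 - q)`. -/
noncomputable def qint (q : ℂ) (m : ℕ) : ℂ := (1 - q ^ m) / (1 - q)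

/-- The finite multiple harmonic `q`-series; in depth one
`z_n(k; q) = ∑_{m=1}^{n-1} q^{(k-1)m}/[m]_q^k`. -/
noncomputable def zq (q : ℂ) : List ℕ → ℕ → ℂ
  | [], _ => 1
  | k :: ks, n => ∑ m ∈ Finset.Ioo 0 n, q ^ ((k - 1) * m) / qint q m ^ k * zq q ks m

theorem IsPrimitiveRoot.sum_pow_mul_eq_zero {ζ : ℂ} {n j : ℕ} (hζ : IsPrimitiveRoot ζ n)
    (hj : 0 < j) (hjn : j < n) : ∑ m ∈ Finset.range n, (ζ ^ m) ^ j = 0 := by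
  have h1 : ζ ^ j - 1 ≠ 0 := sub_ne_zero.2 (hζ.pow_ne_one_of_pos_of_lt hj.ne' hjn)
  have h2 := mul_geom_sum (ζ ^ j) n
  rw [← pow_mul, mul_comm j n, pow_mul, hζ.pow_eq_one, one_pow, sub_self] at h2
  rw [← (mul_eq_zero.1 h2).resolve_left h1]
  exact Finset.sum_congr rfl fun m _ ↦ by rw [← pow_mul, ← pow_mul, mul_comm]

/-- Partial fractions of `n / (1 - y ^ n)`. -/
theorem IsPrimitiveRoot.sum_inv_one_sub_pow_mul {ζ y : ℂ} {n : ℕ} (hζ : IsPrimitiveRoot ζ n)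
    (hn : 0 < n) (hy : y ^ n ≠ 1) :
    ∑ m ∈ Finset.range n, (1 - ζ ^ m * y)⁻¹ = n / (1 - y ^ n) := by
  have hpow (m : ℕ) : (ζ ^ m * y) ^ n = y ^ n := by
    rw [mul_pow, ← pow_mul, mul_comm m n, pow_mul, hζ.pow_eq_one, one_pow, one_mul]
  have hne (m : ℕ) : 1 - ζ ^ m * y ≠ 0 := fun h ↦ hy <| by
    rw [← hpow m, ← sub_eq_zero.1 h, one_pow]
  rw [eq_div_iff (sub_ne_zero.2 hy.symm), Finset.sum_mul]
  calc ∑ m ∈ Finset.range n, (1 - ζ ^ m * y)⁻¹ * (1 - y ^ n)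
      = ∑ m ∈ Finset.range n, ∑ j ∈ Finset.range n, (ζ ^ m) ^ j * y ^ j := by
        refine Finset.sum_congr rfl fun m _ ↦ ?_
        rw [inv_mul_eq_iff_eq_mul₀ (hne m), ← hpow m, ← mul_neg_geom_sum]
        simp only [mul_pow]
    _ = ∑ j ∈ Finset.range n, (∑ m ∈ Finset.range n, (ζ ^ m) ^ j) * y ^ j := by
        rw [Finset.sum_comm]
        simp only [Finset.sum_mul]
    _ = n := by
        rw [Finset.sum_eq_single_of_mem 0 (Finset.mem_range.2 hn)]
        · simp
        · intro j hj hj0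
          rw [hζ.sum_pow_mul_eq_zero (Nat.pos_of_ne_zero hj0) (Finset.mem_range.1 hj), zero_mul]

theorem zq_singleton_mul_pow {ζ : ℂ} (hζ : ζ ≠ 1) (n k : ℕ) (x : ℂ) :
    zq ζ [k + 1] n * (x / (1 - ζ)) ^ (k + 1) =
      ∑ m ∈ Finset.Ioo 0 n, x / (1 - ζ ^ m) * (ζ ^ m * (x / (1 - ζ ^ m))) ^ k := by
  have h1 : 1 - ζ ≠ 0 := sub_ne_zero.2 hζ.symm
  simp only [zq, qint, mul_one, Nat.add_sub_cancel, Finset.sum_mul]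
  refine Finset.sum_congr rfl fun m _ ↦ ?_
  have h2 : x / (1 - ζ ^ m) = x / (1 - ζ) / ((1 - ζ ^ m) / (1 - ζ)) := by
    rw [div_div_div_cancel_right₀ h1]
  rw [h2, mul_comm k m, pow_mul, mul_pow, div_pow (x / (1 - ζ))]
  generalize (1 - ζ ^ m) / (1 - ζ) = c
  ring

/-- Generating function of the depth-one values: for `n ≥ 2`, a primitive `n`-th root of
unity `ζ_n` and `0 < |x| < min_{0<m<n} |1 - ζ_n^m|`, one has `(1+x)^n ≠ 1`, the series
`∑_{k≥1} z_n(k; ζ_n)·(x/(1-ζ_n))^k` converges absolutely, and its sum is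
`n·x/(1-(1+x)^n) + 1`. -/
theorem stmt_10 (n : ℕ) (hn : 2 ≤ n) (ζ : ℂ) (hζ : IsPrimitiveRoot ζ n) (x : ℂ)
    (hx0 : 0 < ‖x‖) (hx : ∀ m : ℕ, 0 < m → m < n → ‖x‖ < ‖1 - ζ ^ m‖) :
    (1 + x) ^ n ≠ 1 ∧
    Summable (fun k : ℕ => ‖zq ζ [k + 1] n * (x / (1 - ζ)) ^ (k + 1)‖) ∧
    ∑' k : ℕ, zq ζ [k + 1] n * (x / (1 - ζ)) ^ (k + 1) =
      n * x / (1 - (1 + x) ^ n) + 1 := by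
  have hn0 : 0 < n := by omega
  have hxne : x ≠ 0 := norm_pos_iff.1 hx0
  have hpow : (1 + x) ^ n ≠ 1 := by
    intro h
    have : NeZero n := ⟨hn0.ne'⟩
    obtain ⟨i, hi, hix⟩ := hζ.eq_pow_of_pow_eq_one h
    rcases Nat.eq_zero_or_pos i with rfl | hi0
    · exact hxne (by simpa using hix)
    · have := hx i hi0 hi
      rw [hix, sub_add_cancel_left, norm_neg] at this
      exact lt_irrefl _ this
  have hζ1 : ζ ≠ 1 := hζ.ne_one (by omega)
  have hlt : ∀ m ∈ Finset.Ioo 0 n, ‖ζ ^ m * (x / (1 - ζ ^ m))‖ < 1 := by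
    intro m hm
    obtain ⟨h0, h1⟩ := Finset.mem_Ioo.1 hm
    have h := hx m h0 h1
    rw [norm_mul, norm_pow, hζ.norm'_eq_one hn0.ne', one_pow, one_mul, norm_div]
    exact (div_lt_one (hx0.trans h)).2 h
  simp only [zq_singleton_mul_pow hζ1]
  have hsum : ∀ m ∈ Finset.Ioo 0 n,
      HasSum (fun k : ℕ ↦ x / (1 - ζ ^ m) * (ζ ^ m * (x / (1 - ζ ^ m))) ^ k)
        (x * (1 - ζ ^ m * (1 + x))⁻¹) := by
    intro m hm
    obtain ⟨h0, h1⟩ := Finset.mem_Ioo.1 hm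
    have hne : 1 - ζ ^ m ≠ 0 := norm_pos_iff.1 (hx0.trans (hx m h0 h1))
    have hval : x * (1 - ζ ^ m * (1 + x))⁻¹ =
        x / (1 - ζ ^ m) * (1 - ζ ^ m * (x / (1 - ζ ^ m)))⁻¹ := by
      rw [div_eq_mul_inv, mul_assoc, ← mul_inv]
      congr 2
      field_simp
      ring
    rw [hval]
    exact (hasSum_geometric_of_norm_lt_one (hlt m hm)).mul_left (x / (1 - ζ ^ m))
  have htot := hasSum_sum hsum
  refine ⟨hpow, htot.summable.norm, ?_⟩
  rw [htot.tsum_eq, ← Finset.mul_sum]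
  have hpf := hζ.sum_inv_one_sub_pow_mul hn0 hpow
  have hIoo : Finset.range n = insert 0 (Finset.Ioo 0 n) := by
    ext m
    simp only [Finset.mem_range, Finset.mem_insert, Finset.mem_Ioo]
    omega
  rw [hIoo, Finset.sum_insert (by simp), pow_zero, one_mul, sub_add_cancel_left] at hpf
  rw [eq_sub_of_add_eq' hpf, mul_sub, inv_neg, mul_neg, mul_inv_cancel₀ hxne]
  ring
end

section
/- Let n ≥ 1 be an integer and ζ_n ∈ ℂ a primitive n-th root of unity. Then z_n(1;ζ_n) = ((n−1)/2)·(1−ζ_n), z_n(2;ζ_n) = −((n²−1)/12)·(1−ζ_n)², z_n(3;ζ_n) = ((n²−1)/24)·(1−ζ_n)³, and z_n(4;ζ_n) = ((n²−1)(n²−19)/720)·(1−ζ_n)⁴. -/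
/-- The twisted sum `∑_{0 < m < n} ζ^{m(b+1)} / (1 - ζ^m)^k`. -/
noncomputable def twistedSum (ζ : ℂ) (n k b : ℕ) : ℂ :=
  ∑ m ∈ Finset.Ioo 0 n, ζ ^ (m * (b + 1)) / (1 - ζ ^ m) ^ k

lemma IsPrimitiveRoot.one_sub_pow_ne_zero {ζ : ℂ} {n m : ℕ} (hζ : IsPrimitiveRoot ζ n)
    (hm : m ∈ Finset.Ioo 0 n) : 1 - ζ ^ m ≠ 0 := by
  rw [Finset.mem_Ioo] at hm
  exact sub_ne_zero.mpr (hζ.pow_ne_one_of_pos_of_lt hm.1.ne' hm.2).symm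

lemma twistedSum_succ_sub {ζ : ℂ} {n : ℕ} (hζ : IsPrimitiveRoot ζ n) (k b : ℕ) :
    twistedSum ζ n (k + 1) b - twistedSum ζ n (k + 1) (b + 1) = twistedSum ζ n k b := by
  unfold twistedSum
  rw [← Finset.sum_sub_distrib]
  refine Finset.sum_congr rfl fun m hm => ?_
  have h := hζ.one_sub_pow_ne_zero hm
  have e : ζ ^ (m * (b + 1 + 1)) = ζ ^ (m * (b + 1)) * ζ ^ m := by ring
  rw [e]
  field_simp
  ring

lemma twistedSum_add_period {ζ : ℂ} {n : ℕ} (hζ : IsPrimitiveRoot ζ n) (k b : ℕ) :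
    twistedSum ζ n k (b + n) = twistedSum ζ n k b := by
  refine Finset.sum_congr rfl fun m _ => ?_
  have e : ζ ^ (m * (b + n + 1)) = ζ ^ (m * (b + 1)) * (ζ ^ n) ^ m := by ring
  rw [e, hζ.pow_eq_one, one_pow, mul_one]

lemma sum_twistedSum {ζ : ℂ} {n : ℕ} (hζ : IsPrimitiveRoot ζ n) (k : ℕ) :
    ∑ b ∈ Finset.range n, twistedSum ζ n k b = 0 := by
  have h := twistedSum_add_period hζ (k + 1) 0
  rw [zero_add] at h
  simp_rw [← twistedSum_succ_sub hζ k]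
  rw [Finset.sum_range_sub', h, sub_self]

lemma twistedSum_zero {ζ : ℂ} {n b : ℕ} (hζ : IsPrimitiveRoot ζ n) (hb : b + 1 < n) :
    twistedSum ζ n 0 b = -1 := by
  have h1 : ζ ^ (b + 1) ≠ 1 := hζ.pow_ne_one_of_pos_of_lt b.succ_ne_zero hb
  have h2 : ∑ m ∈ Finset.range n, (ζ ^ (b + 1)) ^ m = 0 := by
    rw [geom_sum_eq h1, ← pow_mul, mul_comm, pow_mul, hζ.pow_eq_one, one_pow, sub_self, zero_div]
  have h3 : Finset.range n = insert 0 (Finset.Ioo 0 n) := by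
    ext m
    simp only [Finset.mem_range, Finset.mem_insert, Finset.mem_Ioo]
    omega
  rw [h3, Finset.sum_insert (by simp), pow_zero] at h2
  have h4 : twistedSum ζ n 0 b = ∑ m ∈ Finset.Ioo 0 n, (ζ ^ (b + 1)) ^ m := by
    refine Finset.sum_congr rfl fun m _ => ?_
    rw [pow_zero, div_one, ← pow_mul, mul_comm]
  rw [h4]
  linear_combination h2

/-- A sequence `p` with the differences of `twistedSum ζ n (k + 1)` on an initial segment and
mean zero over a period, the latter witnessed by an antidifference `P`, agrees with it there. -/
lemma twistedSum_succ_eq {ζ : ℂ} {n N k : ℕ} (hζ : IsPrimitiveRoot ζ n) (hn : 1 ≤ n)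
    (hN : n ≤ N + 1) (p P : ℕ → ℂ)
    (hp : ∀ b < N, twistedSum ζ n k b = p b - p (b + 1))
    (hP : ∀ b, p b = P b - P (b + 1)) (hP0 : P 0 = P n) :
    ∀ b ≤ N, twistedSum ζ n (k + 1) b = p b := by
  have hconst : ∀ b ≤ N,
      twistedSum ζ n (k + 1) b - p b = twistedSum ζ n (k + 1) 0 - p 0 := by
    intro b
    induction b with
    | zero => exact fun _ => rfl
    | succ b ih =>
      intro hb
      linear_combination ih (by omega) - hp b (by omega) - twistedSum_succ_sub hζ k b
  have hsum : ∑ b ∈ Finset.range n, (twistedSum ζ n (k + 1) b - p b) = 0 := by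
    rw [Finset.sum_sub_distrib, sum_twistedSum hζ, Finset.sum_congr rfl fun b _ => hP b,
      Finset.sum_range_sub', hP0]
    ring
  have hzero : twistedSum ζ n (k + 1) 0 - p 0 = 0 := by
    rw [Finset.sum_congr rfl fun b hb => hconst b (by rw [Finset.mem_range] at hb; omega),
      Finset.sum_const, Finset.card_range, nsmul_eq_mul] at hsum
    exact (mul_eq_zero.mp hsum).resolve_left (Nat.cast_ne_zero.mpr (by omega))
  intro b hb
  exact sub_eq_zero.mp ((hconst b hb).trans hzero)

lemma zq_singleton (ζ : ℂ) (n k : ℕ) :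
    zq ζ [k] n =
      (∑ m ∈ Finset.Ioo 0 n, ζ ^ (m * (k - 1)) / (1 - ζ ^ m) ^ k) * (1 - ζ) ^ k := by
  simp only [zq, qint, mul_one, Finset.sum_mul]
  refine Finset.sum_congr rfl fun m _ => ?_
  rw [div_pow, div_div_eq_mul_div, mul_comm m, div_mul_eq_mul_div]

lemma zq_singleton_eq_twistedSum (ζ : ℂ) (n k : ℕ) :
    zq ζ [k + 2] n = twistedSum ζ n (k + 2) k * (1 - ζ) ^ (k + 2) :=
  zq_singleton ζ n (k + 2)

lemma zq_one_eq_twistedSum {ζ : ℂ} {n : ℕ} (hζ : IsPrimitiveRoot ζ n) (hn : 1 ≤ n) :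
    zq ζ [1] n = twistedSum ζ n 1 (n - 1) * (1 - ζ) := by
  rw [zq_singleton, pow_one, twistedSum, Nat.sub_add_cancel hn]
  congr 1
  refine Finset.sum_congr rfl fun m _ => ?_
  rw [Nat.sub_self, mul_zero, pow_zero, pow_one, mul_comm m n, pow_mul, hζ.pow_eq_one, one_pow]

/-- For `k ≤ 4`, the polynomial in `z = n` and `x = b` that computes `twistedSum ζ n k b` for
`b < n + k - 1`; the value at `k = 5` is an antidifference of the one at `k = 4`. -/
noncomputable def twistedPoly (z : ℂ) (k : ℕ) (x : ℂ) : ℂ :=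
  match k with
  | 1 => x - (z - 1) / 2
  | 2 => -(x * (x - 1) / 2) + (z - 1) / 2 * x - (z ^ 2 - 1) / 12
  | 3 => x * (x - 1) * (x - 2) / 6 - (z - 1) / 2 * (x * (x - 1) / 2) +
      (z ^ 2 - 1) / 12 * x - (z ^ 2 - 1) / 24
  | 4 => -(x * (x - 1) * (x - 2) * (x - 3) / 24) + (z - 1) / 2 * (x * (x - 1) * (x - 2) / 6) -
      (z ^ 2 - 1) / 12 * (x * (x - 1) / 2) + (z ^ 2 - 1) / 24 * x +
      (z ^ 2 - 1) * (z ^ 2 - 19) / 720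
  | 5 => x * (x - 1) * (x - 2) * (x - 3) * (x - 4) / 120 -
      (z - 1) / 2 * (x * (x - 1) * (x - 2) * (x - 3) / 24) +
      (z ^ 2 - 1) / 12 * (x * (x - 1) * (x - 2) / 6) - (z ^ 2 - 1) / 24 * (x * (x - 1) / 2) -
      (z ^ 2 - 1) * (z ^ 2 - 19) / 720 * x
  | _ => -1

lemma twistedPoly_sub (z x : ℂ) {k : ℕ} (hk : k ≤ 4) :
    twistedPoly z k x = twistedPoly z (k + 1) x - twistedPoly z (k + 1) (x + 1) := by
  interval_cases k <;> simp only [twistedPoly] <;> ring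

lemma twistedPoly_zero_eq_self (z : ℂ) {k : ℕ} (hk : k ≤ 3) :
    twistedPoly z (k + 2) 0 = twistedPoly z (k + 2) z := by
  interval_cases k <;> simp only [twistedPoly] <;> ring

lemma twistedSum_eq_twistedPoly {ζ : ℂ} {n k : ℕ} (hζ : IsPrimitiveRoot ζ n) (hn : 1 ≤ n)
    (hk : k ≤ 4) : ∀ b < n - 1 + k, twistedSum ζ n k b = twistedPoly n k b := by
  induction k with
  | zero => exact fun b hb => twistedSum_zero hζ (by omega)
  | succ k ih =>
    intro b hb
    refine twistedSum_succ_eq (N := n - 1 + k) hζ hn (by omega)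
      (fun b => twistedPoly n (k + 1) b) (fun b => twistedPoly n (k + 2) b)
      (fun b hb => ?_) (fun b => ?_) ?_ b (by omega)
    · rw [ih (by omega) b hb, Nat.cast_succ, twistedPoly_sub _ _ (by omega)]
    · rw [Nat.cast_succ, twistedPoly_sub _ _ hk]
    · rw [Nat.cast_zero, twistedPoly_zero_eq_self _ (by omega)]

/-- The depth-one values at a primitive `n`-th root of unity:
`z_n(1;ζ_n) = ((n-1)/2)(1-ζ_n)`, `z_n(2;ζ_n) = -((n²-1)/12)(1-ζ_n)²`,
`z_n(3;ζ_n) = ((n²-1)/24)(1-ζ_n)³`, `z_n(4;ζ_n) = ((n²-1)(n²-19)/720)(1-ζ_n)⁴`. -/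
theorem stmt_11 (n : ℕ) (hn : 1 ≤ n) (ζ : ℂ) (hζ : IsPrimitiveRoot ζ n) :
    zq ζ [1] n = (((n : ℂ) - 1) / 2) * (1 - ζ) ∧
    zq ζ [2] n = -(((n : ℂ) ^ 2 - 1) / 12) * (1 - ζ) ^ 2 ∧
    zq ζ [3] n = (((n : ℂ) ^ 2 - 1) / 24) * (1 - ζ) ^ 3 ∧
    zq ζ [4] n = (((n : ℂ) ^ 2 - 1) * ((n : ℂ) ^ 2 - 19) / 720) * (1 - ζ) ^ 4 := by
  refine ⟨?_, ?_, ?_, ?_⟩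
  · rw [zq_one_eq_twistedSum hζ hn, twistedSum_eq_twistedPoly hζ hn (by omega) _ (by omega),
      Nat.cast_sub hn]
    simp only [twistedPoly, Nat.cast_one]
    ring
  all_goals
    rw [zq_singleton_eq_twistedSum,
      twistedSum_eq_twistedPoly hζ hn (by omega) _ (by omega)]
    simp only [twistedPoly, Nat.cast_zero, Nat.cast_one, Nat.cast_ofNat]
    ring
end

section
/- For every integer k ≥ 1 there exists a polynomial D_k(x) ∈ ℚ[x] of degree at most k such that z_n(k;ζ_n) = D_k(n)·(1−ζ_n)^k for every integer n ≥ 1 and every primitive n-th root of unity ζ_n ∈ ℂ; moreover D_k(0) = −G_k, where G_k is the k-th Gregory coefficient. -/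
/-- The Gregory coefficients `G_k`, characterized by `G_0 = 1` and
`∑_{j=0}^{k} (-1)^{k-j} G_j/(k-j+1) = 0` for `k ≥ 1` (equivalently
`z/log(1+z) = ∑_{k≥0} G_k z^k`); so `G_1 = 1/2`, `G_2 = -1/12`, `G_3 = 1/24`,
`G_4 = -19/720`. -/
def gregory : ℕ → ℚ
  | 0 => 1
  | k + 1 => -∑ j : Fin (k + 1),
      (-1 : ℚ) ^ (k + 1 - (j : ℕ)) * gregory j / ((k + 2 - (j : ℕ) : ℕ) : ℚ)

open Polynomial in
/-- The polynomial `(x-1)(x-2)⋯(x-j)/(j+1)!`, whose value at `n ≥ 1` is `binom(n, j+1)/n`. -/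
noncomputable def reducedChoose (j : ℕ) : ℚ[X] :=
  C (((j + 1).factorial : ℚ)⁻¹) * (descPochhammer ℚ j).comp (X - 1)

open Polynomial in
/-- The coefficients, as polynomials in `x`, of the series `x t / ((1 + t)^x - 1)` in `t`. -/
noncomputable def gregoryPoly : ℕ → ℚ[X]
  | 0 => 1
  | k + 1 => -∑ j : Fin (k + 1), gregoryPoly j * reducedChoose (k + 1 - (j : ℕ))

open Polynomial in
theorem natDegree_reducedChoose_le (j : ℕ) : (reducedChoose j).natDegree ≤ j := by
  unfold reducedChoose
  refine (natDegree_C_mul_le _ _).trans ?_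
  rw [natDegree_comp, descPochhammer_natDegree]
  have : (X - 1 : ℚ[X]).natDegree = 1 := by simpa using natDegree_X_sub_C (1 : ℚ)
  rw [this, mul_one]

theorem descPochhammer_eval_neg_one (j : ℕ) :
    (descPochhammer ℚ j).eval (-1) = (-1) ^ j * (j.factorial : ℚ) := by
  induction j with
  | zero => simp
  | succ j ih =>
    rw [descPochhammer_succ_eval, ih, Nat.factorial_succ]
    push_cast
    ring

theorem reducedChoose_eval_zero (j : ℕ) :
    (reducedChoose j).eval 0 = (-1) ^ j / ((j + 1 : ℕ) : ℚ) := by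
  have h : (j.factorial : ℚ) ≠ 0 := by exact_mod_cast j.factorial_ne_zero
  have h' : ((j + 1 : ℕ) : ℚ) ≠ 0 := by exact_mod_cast j.succ_ne_zero
  simp only [reducedChoose, Polynomial.eval_mul, Polynomial.eval_C, Polynomial.eval_comp,
    Polynomial.eval_sub, Polynomial.eval_X, Polynomial.eval_one, zero_sub,
    descPochhammer_eval_neg_one, Nat.factorial_succ, Nat.cast_mul]
  field_simp

theorem mul_reducedChoose_eval (n j : ℕ) :
    (n : ℚ) * (reducedChoose j).eval (n : ℚ) = (n.choose (j + 1) : ℚ) := by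
  have h : ((j + 1).factorial : ℚ) ≠ 0 := by exact_mod_cast (j + 1).factorial_ne_zero
  have key := descPochhammer_eval_eq_descFactorial ℚ n (j + 1)
  rw [descPochhammer_succ_left, Nat.descFactorial_eq_factorial_mul_choose] at key
  simp only [Polynomial.eval_mul, Polynomial.eval_X, Nat.cast_mul] at key
  rw [reducedChoose, Polynomial.eval_mul, Polynomial.eval_C, mul_left_comm, key,
    inv_mul_cancel_left₀ h]

theorem reducedChoose_zero : reducedChoose 0 = 1 := by
  simp [reducedChoose]

theorem natDegree_gregoryPoly_le (k : ℕ) : (gregoryPoly k).natDegree ≤ k := by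
  induction k using Nat.strong_induction_on with
  | _ k ih =>
    cases k with
    | zero => simp [gregoryPoly]
    | succ k =>
      rw [gregoryPoly, Polynomial.natDegree_neg]
      refine Polynomial.natDegree_sum_le_of_forall_le _ _ fun j _ => ?_
      refine Polynomial.natDegree_mul_le.trans ?_
      have h₁ := ih j j.isLt
      have h₂ := natDegree_reducedChoose_le (k + 1 - j)
      have := j.isLt
      omega

theorem gregoryPoly_eval_zero (k : ℕ) : (gregoryPoly k).eval 0 = gregory k := by
  induction k using Nat.strong_induction_on with
  | _ k ih =>
    cases k with
    | zero => simp [gregoryPoly, gregory]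
    | succ k =>
      rw [gregoryPoly, gregory, Polynomial.eval_neg, Polynomial.eval_finsetSum]
      congr 1
      refine Finset.sum_congr rfl fun j _ => ?_
      have hj := j.isLt
      rw [Polynomial.eval_mul, ih j j.isLt, reducedChoose_eval_zero,
        show k + 1 - (j : ℕ) + 1 = k + 2 - j by omega]
      ring

theorem mk_gregoryPoly_mul_mk_reducedChoose :
    PowerSeries.mk gregoryPoly * PowerSeries.mk reducedChoose = 1 := by
  ext1 k
  rw [PowerSeries.coeff_mul, Finset.Nat.sum_antidiagonal_eq_sum_range_succ_mk]
  simp only [PowerSeries.coeff_mk, PowerSeries.coeff_one]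
  cases k with
  | zero => simp [gregoryPoly, reducedChoose_zero]
  | succ k =>
    rw [Finset.sum_range_succ, gregoryPoly, Finset.sum_range, Nat.sub_self, reducedChoose_zero]
    simp

theorem mk_reducedChoose_eval (n : ℕ) :
    (n : PowerSeries ℂ) * PowerSeries.X *
      PowerSeries.mk (fun j => (((reducedChoose j).eval (n : ℚ) : ℚ) : ℂ)) =
      (1 + PowerSeries.X) ^ n - 1 := by
  have hX : (1 + PowerSeries.X : PowerSeries ℂ) ^ n
      = (((1 + Polynomial.X) ^ n : Polynomial ℂ) : PowerSeries ℂ) := by simp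
  ext k
  rw [hX, mul_assoc, ← map_natCast (PowerSeries.C (R := ℂ)), PowerSeries.coeff_C_mul, map_sub,
    Polynomial.coeff_coe, Polynomial.coeff_one_add_X_pow, PowerSeries.coeff_one]
  cases k with
  | zero => simp
  | succ k =>
    rw [PowerSeries.coeff_succ_X_mul, PowerSeries.coeff_mk]
    have := congrArg (fun q : ℚ => (q : ℂ)) (mul_reducedChoose_eval n k)
    push_cast at this
    simp [this]

/-- The power series `∑_k w^k / (1 - w)^(k+1) t^k` is the inverse of `1 - (1 + t) w`. -/
theorem one_sub_mul_mk_pow_div {w : ℂ} (hw : w ≠ 1) :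
    (1 - (1 + PowerSeries.X) * PowerSeries.C w) *
      PowerSeries.mk (fun k => w ^ k / (1 - w) ^ (k + 1)) = 1 := by
  have h : (1 - w) ≠ 0 := sub_ne_zero.mpr hw.symm
  have e : (1 - (1 + PowerSeries.X) * PowerSeries.C w : PowerSeries ℂ)
      = PowerSeries.C (1 - w) - PowerSeries.C w * PowerSeries.X := by
    rw [map_sub, map_one]; ring
  ext k
  rw [e, sub_mul, mul_assoc, map_sub, PowerSeries.coeff_C_mul, PowerSeries.coeff_C_mul,
    PowerSeries.coeff_mk, PowerSeries.coeff_one]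
  cases k with
  | zero => simp [h]
  | succ k =>
    rw [PowerSeries.coeff_succ_X_mul, PowerSeries.coeff_mk]
    simp only [Nat.succ_ne_zero, if_false]
    field_simp
    ring

theorem IsPrimitiveRoot.sum_Ioo_pow_pow {n : ℕ} {ζ : ℂ} (hζ : IsPrimitiveRoot ζ n) {i : ℕ}
    (hi : i < n) :
    ∑ m ∈ Finset.Ioo 0 n, (ζ ^ m) ^ i = (if i = 0 then (n : ℂ) else 0) - 1 := by
  have hn : 0 < n := by omega
  have hr : ∑ m ∈ Finset.range n, (ζ ^ m) ^ i = 1 + ∑ m ∈ Finset.Ioo 0 n, (ζ ^ m) ^ i := by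
    rw [Finset.range_eq_Ico, ← Finset.Ioo_insert_left hn, Finset.sum_insert (by simp)]
    simp
  have hs : ∑ m ∈ Finset.range n, (ζ ^ m) ^ i = if i = 0 then (n : ℂ) else 0 := by
    split_ifs with h
    · simp [h]
    · have h1 : ζ ^ i ≠ 1 := hζ.pow_ne_one_of_pos_of_lt h hi
      have h2 : ∀ m, (ζ ^ m) ^ i = (ζ ^ i) ^ m := fun m => by rw [← pow_mul, ← pow_mul, mul_comm]
      simp only [h2]
      rw [geom_sum_eq h1, ← pow_mul, mul_comm, pow_mul, hζ.pow_eq_one]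
      simp
  rw [← hs, hr]
  ring

theorem IsPrimitiveRoot.one_sub_X_mul_sum_mul {n : ℕ} (hn : 1 ≤ n) {ζ : ℂ}
    (hζ : IsPrimitiveRoot ζ n) :
    (1 - PowerSeries.X * ∑ m ∈ Finset.Ioo 0 n,
      PowerSeries.mk (fun k => (ζ ^ m) ^ k / (1 - ζ ^ m) ^ (k + 1))) *
      ((1 + PowerSeries.X) ^ n - 1) = (n : PowerSeries ℂ) * PowerSeries.X := by
  set x : PowerSeries ℂ := 1 + PowerSeries.X with hx
  have hterm : ∀ m ∈ Finset.Ioo 0 n,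
      PowerSeries.mk (fun k => (ζ ^ m) ^ k / (1 - ζ ^ m) ^ (k + 1)) * (x ^ n - 1) =
        -∑ i ∈ Finset.range n, x ^ i * PowerSeries.C ((ζ ^ m) ^ i) := by
    intro m hm
    rw [Finset.mem_Ioo] at hm
    have hw : ζ ^ m ≠ 1 := hζ.pow_ne_one_of_pos_of_lt hm.1.ne' hm.2
    have h1 := one_sub_mul_mk_pow_div hw
    rw [← hx] at h1
    have h2 := mul_neg_geom_sum (x * PowerSeries.C (ζ ^ m)) n
    have h3 : (PowerSeries.C (ζ ^ m) : PowerSeries ℂ) ^ n = 1 := by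
      rw [← map_pow, ← pow_mul, mul_comm, pow_mul, hζ.pow_eq_one, one_pow, map_one]
    simp only [mul_pow, h3, mul_one] at h2
    simp only [map_pow _ (ζ ^ m)]
    linear_combination (-∑ i ∈ Finset.range n, x ^ i * PowerSeries.C (ζ ^ m) ^ i) * h1 +
      (-PowerSeries.mk (fun k => (ζ ^ m) ^ k / (1 - ζ ^ m) ^ (k + 1))) * -h2
  have hsum : (∑ m ∈ Finset.Ioo 0 n,
      PowerSeries.mk (fun k => (ζ ^ m) ^ k / (1 - ζ ^ m) ^ (k + 1))) * (x ^ n - 1) =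
        ∑ i ∈ Finset.range n, x ^ i - (n : PowerSeries ℂ) := by
    rw [Finset.sum_mul, Finset.sum_congr rfl hterm, Finset.sum_neg_distrib, Finset.sum_comm]
    have : ∀ i ∈ Finset.range n, ∑ m ∈ Finset.Ioo 0 n, x ^ i * PowerSeries.C ((ζ ^ m) ^ i) =
        (if i = 0 then (n : PowerSeries ℂ) else 0) - x ^ i := by
      intro i hi
      rw [← Finset.mul_sum, ← map_sum, hζ.sum_Ioo_pow_pow (Finset.mem_range.mp hi)]
      split_ifs with h
      · simp [h]
      · simp
    rw [Finset.sum_congr rfl this, Finset.sum_sub_distrib, Finset.sum_ite_eq',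
      if_pos (Finset.mem_range.mpr hn)]
    ring
  have hg := mul_geom_sum x n
  have hX : PowerSeries.X = x - 1 := by rw [hx]; ring
  rw [hX]
  linear_combination (-(x - 1)) * hsum - hg

theorem IsPrimitiveRoot.sum_pow_div_eq {n : ℕ} (hn : 1 ≤ n) {ζ : ℂ}
    (hζ : IsPrimitiveRoot ζ n) (k : ℕ) :
    ∑ m ∈ Finset.Ioo 0 n, (ζ ^ m) ^ k / (1 - ζ ^ m) ^ (k + 1) =
      (((-gregoryPoly (k + 1)).eval (n : ℚ) : ℚ) : ℂ) := by
  have hinv : PowerSeries.mk (fun j => (((gregoryPoly j).eval (n : ℚ) : ℚ) : ℂ)) *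
      PowerSeries.mk (fun j => (((reducedChoose j).eval (n : ℚ) : ℚ) : ℂ)) = 1 := by
    have h := congrArg (PowerSeries.map ((algebraMap ℚ ℂ).comp (Polynomial.evalRingHom (n : ℚ))))
      mk_gregoryPoly_mul_mk_reducedChoose
    rw [map_mul, map_one] at h
    exact h
  have hA := hζ.one_sub_X_mul_sum_mul hn
  have hF := mk_reducedChoose_eval n
  rw [← hF] at hA
  have hne : (n : PowerSeries ℂ) * PowerSeries.X ≠ 0 := by
    refine mul_ne_zero ?_ PowerSeries.X_ne_zero
    rw [← map_natCast (PowerSeries.C (R := ℂ))]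
    refine (map_ne_zero_iff _ PowerSeries.C_injective).mpr ?_
    exact_mod_cast (by omega : n ≠ 0)
  have hA' := mul_left_cancel₀ hne
    ((mul_left_comm _ _ _).trans (hA.trans (mul_one _).symm))
  have heq := (mul_comm _ _).trans hA' |> left_inv_eq_right_inv hinv |>.symm
  have hc := congrArg (PowerSeries.coeff (k + 1)) heq
  rw [map_sub, PowerSeries.coeff_succ_X_mul, map_sum, PowerSeries.coeff_mk,
    PowerSeries.coeff_one, if_neg k.succ_ne_zero] at hc
  simp only [PowerSeries.coeff_mk] at hc
  rw [Polynomial.eval_neg, Rat.cast_neg, ← hc]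
  ring

/-- For every `k ≥ 1` there is a polynomial `D_k ∈ ℚ[x]` of degree at most `k` with
`z_n(k; ζ_n) = D_k(n)·(1-ζ_n)^k` for all `n ≥ 1` and all primitive `n`-th roots of unity
`ζ_n`, and `D_k(0) = -G_k`. -/
theorem stmt_12 (k : ℕ) (hk : 1 ≤ k) :
    ∃ D : Polynomial ℚ, D.natDegree ≤ k ∧
      (∀ n : ℕ, 1 ≤ n → ∀ ζ : ℂ, IsPrimitiveRoot ζ n →
        zq ζ [k] n = ((D.eval (n : ℚ) : ℚ) : ℂ) * (1 - ζ) ^ k) ∧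
      D.eval 0 = -gregory k := by
  obtain ⟨k, rfl⟩ := Nat.exists_eq_add_of_le' hk
  refine ⟨-gregoryPoly (k + 1), ?_, fun n hn ζ hζ => ?_, ?_⟩
  · rw [Polynomial.natDegree_neg]
    exact natDegree_gregoryPoly_le _
  · rw [← hζ.sum_pow_div_eq hn k, Finset.sum_mul]
    simp only [zq, qint, mul_one]
    refine Finset.sum_congr rfl fun m _ => ?_
    rw [div_pow, div_div_eq_mul_div, Nat.add_sub_cancel, mul_comm k m, pow_mul]
    ring
  · rw [Polynomial.eval_neg, gregoryPoly_eval_zero]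
end

section
/- For every integer k ≥ 1 there exists an integer N such that for every prime p > N and every primitive p-th root of unity ζ_p ∈ ℂ, the element z_p(k;ζ_p) + G_k·(1−ζ_p)^k of ℤ[ζ_p] lies in the ideal p·ℤ[ζ_p], where G_k is the k-th Gregory coefficient (for p > N the rational number G_k is p-integral, so G_k·(1−ζ_p)^k makes sense in the localization and the congruence z_p(k;ζ_p) ≡ −G_k·(1−ζ_p)^k mod p holds in ℤ[ζ_p] localized away from the denominator of G_k). -/
/-- The generating series `∑_{j ≥ 1} q^(j-1)/(1-q)^j X^j`. -/
noncomputable def harmonicSeries (q : ℂ) : PowerSeries ℂ :=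
  PowerSeries.mk fun j => if j = 0 then 0 else q ^ (j - 1) * (1 - q)⁻¹ ^ j

theorem one_sub_mul_harmonicSeries {q : ℂ} (hq : q ≠ 1) :
    (1 - PowerSeries.C q * (1 + PowerSeries.X)) * harmonicSeries q = PowerSeries.X := by
  have h1 : 1 - q ≠ 0 := sub_ne_zero.mpr (Ne.symm hq)
  have e : (1 - PowerSeries.C q * (1 + PowerSeries.X)) * harmonicSeries q =
      PowerSeries.C (1 - q) * harmonicSeries q -
        PowerSeries.C q * (PowerSeries.X * harmonicSeries q) := by
    rw [map_sub, map_one]; ring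
  rw [e]
  ext n
  rcases n with _ | _ | n
  · simp [harmonicSeries]
  · rw [map_sub, PowerSeries.coeff_C_mul, PowerSeries.coeff_C_mul, PowerSeries.coeff_succ_X_mul]
    simp [harmonicSeries, h1]
  · rw [map_sub, PowerSeries.coeff_C_mul, PowerSeries.coeff_C_mul, PowerSeries.coeff_succ_X_mul]
    simp only [harmonicSeries, PowerSeries.coeff_mk, PowerSeries.coeff_X]
    simp only [Nat.add_eq_zero_iff, one_ne_zero, and_false, if_false, Nat.add_sub_cancel,
      Nat.add_eq_right]
    linear_combination q ^ (n + 1) * (1 - q)⁻¹ ^ (n + 1) * mul_inv_cancel₀ h1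

theorem pow_sub_one_mul_harmonicSeries {q : ℂ} (hq : q ≠ 1) {p : ℕ} (hqp : q ^ p = 1) :
    ((1 + PowerSeries.X) ^ p - 1) * -harmonicSeries q =
      PowerSeries.X * ∑ i ∈ Finset.range p, (PowerSeries.C q * (1 + PowerSeries.X)) ^ i := by
  have h := mul_neg_geom_sum (PowerSeries.C q * (1 + PowerSeries.X)) p
  rw [mul_pow, ← map_pow, hqp, map_one, one_mul] at h
  have h2 := one_sub_mul_harmonicSeries hq
  linear_combination (-(harmonicSeries q)) * h +
    (∑ i ∈ Finset.range p, (PowerSeries.C q * (1 + PowerSeries.X)) ^ i) * h2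

/-- The power series `1 - ∑_{k ≥ 1} (∑_{m=1}^{p-1} ζ^((k-1)m)/(1-ζ^m)^k) X^k`. -/
noncomputable def rootSeries (ζ : ℂ) (p : ℕ) : PowerSeries ℂ :=
  1 - ∑ m ∈ Finset.Ioo 0 p, harmonicSeries (ζ ^ m)

theorem rootSeries_mul {p : ℕ} (hp : 1 < p) {ζ : ℂ} (hζ : IsPrimitiveRoot ζ p) :
    rootSeries ζ p * ((1 + PowerSeries.X) ^ p - 1) = PowerSeries.X * (p : PowerSeries ℂ) := by
  have hIoo : ∀ m ∈ Finset.Ioo 0 p, ((1 + PowerSeries.X) ^ p - 1) * -harmonicSeries (ζ ^ m) =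
      PowerSeries.X *
        ∑ i ∈ Finset.range p, (PowerSeries.C (ζ ^ m) * (1 + PowerSeries.X)) ^ i := by
    intro m hm
    rw [Finset.mem_Ioo] at hm
    refine pow_sub_one_mul_harmonicSeries (hζ.pow_ne_one_of_pos_of_lt hm.1.ne' hm.2) ?_
    rw [pow_right_comm, hζ.pow_eq_one, one_pow]
  have hzero : ((1 + PowerSeries.X) ^ p - 1 : PowerSeries ℂ) =
      PowerSeries.X *
        ∑ i ∈ Finset.range p, (PowerSeries.C (ζ ^ 0) * (1 + PowerSeries.X)) ^ i := by
    have h := mul_geom_sum (1 + PowerSeries.X : PowerSeries ℂ) p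
    rw [pow_zero, map_one, one_mul, ← h]
    ring
  have hrange : Finset.range p = insert 0 (Finset.Ioo 0 p) := by
    ext m
    simp only [Finset.mem_range, Finset.mem_insert, Finset.mem_Ioo]
    omega
  have hsum : rootSeries ζ p * ((1 + PowerSeries.X) ^ p - 1) =
      ∑ m ∈ Finset.range p, PowerSeries.X *
        ∑ i ∈ Finset.range p, (PowerSeries.C (ζ ^ m) * (1 + PowerSeries.X)) ^ i := by
    rw [hrange, Finset.sum_insert (by simp), ← hrange, ← hzero, ← Finset.sum_congr rfl hIoo,
      ← Finset.mul_sum, Finset.sum_neg_distrib, rootSeries]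
    ring
  rw [hsum, ← Finset.mul_sum, Finset.sum_comm]
  congr 1
  have hterm : ∀ i ∈ Finset.range p,
      ∑ m ∈ Finset.range p, (PowerSeries.C (ζ ^ m) * (1 + PowerSeries.X)) ^ i =
        if i = 0 then (p : PowerSeries ℂ) else 0 := by
    intro i hi
    split_ifs with h0
    · simp [h0]
    · have h1 : ζ ^ i ≠ 1 := hζ.pow_ne_one_of_pos_of_lt h0 (Finset.mem_range.mp hi)
      have h2 : ∑ m ∈ Finset.range p, (ζ ^ m) ^ i = 0 := by
        simp_rw [pow_right_comm ζ _ i]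
        rw [geom_sum_eq h1, pow_right_comm, hζ.pow_eq_one, one_pow, sub_self, zero_div]
      simp_rw [mul_pow, ← Finset.sum_mul, ← map_pow, ← map_sum, h2, map_zero, zero_mul]
  rw [Finset.sum_congr rfl hterm]
  simp [(zero_lt_one.trans hp).ne']

theorem coeff_zero_rootSeries (ζ : ℂ) (p : ℕ) : PowerSeries.coeff 0 (rootSeries ζ p) = 1 := by
  simp [rootSeries, harmonicSeries]

theorem coeff_one_add_X_pow_sub_one (p n : ℕ) :
    PowerSeries.coeff (n + 1) ((1 + PowerSeries.X) ^ p - 1 : PowerSeries ℂ) =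
      (p.choose (n + 1) : ℂ) := by
  have h : ((1 + PowerSeries.X) ^ p : PowerSeries ℂ) =
      (((1 + Polynomial.X) ^ p : Polynomial ℂ) : PowerSeries ℂ) := by simp
  rw [map_sub, h, Polynomial.coeff_coe, Polynomial.coeff_one_add_X_pow]
  simp [PowerSeries.coeff_one]

theorem coeff_succ_rootSeries {p : ℕ} (hp : 1 < p) {ζ : ℂ} (hζ : IsPrimitiveRoot ζ p) (k : ℕ) :
    PowerSeries.coeff (k + 1) (rootSeries ζ p) = -∑ j : Fin (k + 1),
      PowerSeries.coeff (j : ℕ) (rootSeries ζ p) * ((p.choose (k + 1 - j + 1) : ℂ) / p) := by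
  have h := congrArg (PowerSeries.coeff (k + 2)) (rootSeries_mul hp hζ)
  have hp0 : (p : ℂ) ≠ 0 := by exact_mod_cast (zero_lt_one.trans hp).ne'
  rw [PowerSeries.coeff_mul, Finset.Nat.sum_antidiagonal_eq_sum_range_succ_mk,
    Finset.sum_range_succ, Finset.sum_range_succ, PowerSeries.coeff_succ_X_mul] at h
  have hc : PowerSeries.coeff (k + 1) (p : PowerSeries ℂ) = 0 := by
    rw [← map_natCast (PowerSeries.C (R := ℂ)), PowerSeries.coeff_C, if_neg k.succ_ne_zero]
  have hs : ∑ j ∈ Finset.range (k + 1), PowerSeries.coeff j (rootSeries ζ p) *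
      PowerSeries.coeff (k + 2 - j) ((1 + PowerSeries.X) ^ p - 1 : PowerSeries ℂ) =
      ∑ j ∈ Finset.range (k + 1), PowerSeries.coeff j (rootSeries ζ p) *
        (p.choose (k + 1 - j + 1) : ℂ) := by
    refine Finset.sum_congr rfl fun j hj => ?_
    have hj' := Finset.mem_range.mp hj
    rw [show k + 2 - j = (k + 1 - j) + 1 by omega, coeff_one_add_X_pow_sub_one]
  rw [hc, hs, show k + 2 - (k + 1) = 0 + 1 by omega, coeff_one_add_X_pow_sub_one] at h
  simp only [Nat.sub_self, PowerSeries.coeff_zero_eq_constantCoeff, map_sub, map_pow, map_add,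
    map_one, PowerSeries.constantCoeff_X, add_zero, one_pow, sub_self, mul_zero, zero_add,
    Nat.choose_one_right] at h
  rw [Fin.sum_univ_eq_sum_range (fun j => PowerSeries.coeff j (rootSeries ζ p) *
    ((p.choose (k + 1 - j + 1) : ℂ) / p))]
  simp_rw [← mul_div_assoc]
  rw [← Finset.sum_div, ← neg_div, eq_div_iff hp0]
  linear_combination h

theorem zq_singleton_s13 (ζ : ℂ) {k : ℕ} (hk : 1 ≤ k) (p : ℕ) :
    zq ζ [k] p = -PowerSeries.coeff k (rootSeries ζ p) * (1 - ζ) ^ k := by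
  have hk0 : k ≠ 0 := by omega
  simp only [zq, qint, rootSeries, harmonicSeries, map_sub, map_sum, PowerSeries.coeff_mk,
    PowerSeries.coeff_one, if_neg hk0, zero_sub, neg_neg, Finset.sum_mul]
  refine Finset.sum_congr rfl fun m _ => ?_
  rw [mul_comm (k - 1) m, pow_mul, div_pow, inv_pow, mul_one, div_div_eq_mul_div]
  ring

/-- The complex numbers that are rational with denominator prime to `p`. -/
def localIntegers {p : ℕ} (hp : p.Prime) : Subring ℂ where
  carrier := {x | ∃ c : ℤ, ¬ (p : ℤ) ∣ c ∧ ∃ w : ℤ, (c : ℂ) * x = w}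
  mul_mem' := by
    rintro x y ⟨c, hc, w, hw⟩ ⟨d, hd, v, hv⟩
    refine ⟨c * d, (Nat.prime_iff_prime_int.mp hp).not_dvd_mul hc hd, w * v, ?_⟩
    push_cast
    rw [← hw, ← hv]
    ring
  one_mem' := ⟨1, (Nat.prime_iff_prime_int.mp hp).not_dvd_one, 1, by simp⟩
  add_mem' := by
    rintro x y ⟨c, hc, w, hw⟩ ⟨d, hd, v, hv⟩
    refine ⟨c * d, (Nat.prime_iff_prime_int.mp hp).not_dvd_mul hc hd, w * d + c * v, ?_⟩
    push_cast
    rw [← hw, ← hv]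
    ring
  zero_mem' := ⟨1, (Nat.prime_iff_prime_int.mp hp).not_dvd_one, 0, by simp⟩
  neg_mem' := by
    rintro x ⟨c, hc, w, hw⟩
    exact ⟨c, hc, -w, by push_cast; rw [← hw]; ring⟩

theorem inv_natCast_mem_localIntegers {p : ℕ} (hp : p.Prime) {n : ℕ} (h0 : 0 < n) (hn : n < p) :
    (n : ℂ)⁻¹ ∈ localIntegers hp := by
  refine ⟨n, fun h => (Nat.le_of_dvd h0 (Int.natCast_dvd_natCast.mp h)).not_gt hn, 1, ?_⟩
  have : (n : ℂ) ≠ 0 := by exact_mod_cast h0.ne'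
  simp [this]

/-- The multiples of `p` in `localIntegers`. -/
def localMultiples {p : ℕ} (hp : p.Prime) : AddSubgroup ℂ :=
  (localIntegers hp).toAddSubgroup.map (AddMonoidHom.mulLeft (p : ℂ))

theorem mem_localMultiples {p : ℕ} {hp : p.Prime} {x : ℂ} :
    x ∈ localMultiples hp ↔ ∃ u ∈ localIntegers hp, (p : ℂ) * u = x := by
  simp [localMultiples, AddSubgroup.mem_map]

theorem mul_sub_mul_mem_localMultiples {p : ℕ} {hp : p.Prime} {a b g h : ℂ}
    (ha : a - g ∈ localMultiples hp) (hb : b - h ∈ localMultiples hp)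
    (hg : g ∈ localIntegers hp) (hh : h ∈ localIntegers hp) :
    a * b - g * h ∈ localMultiples hp := by
  obtain ⟨u, hu, hua⟩ := mem_localMultiples.mp ha
  obtain ⟨v, hv, hvb⟩ := mem_localMultiples.mp hb
  refine mem_localMultiples.mpr ⟨u * h + g * v + p * u * v, ?_, ?_⟩
  · exact add_mem (add_mem (mul_mem hu hh) (mul_mem hg hv))
      (mul_mem (mul_mem (natCast_mem _ p) hu) hv)
  · linear_combination (h + p * v) * hua + a * hvb

theorem dvd_choose_pred_sub {p : ℕ} (hp : p.Prime) {n : ℕ} (hn : n < p) :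
    (p : ℤ) ∣ ((p - 1).choose n : ℤ) - (-1) ^ n := by
  induction n with
  | zero => simp
  | succ n ih =>
    have h1 : (p : ℤ) ∣ (p.choose (n + 1) : ℤ) :=
      Int.natCast_dvd_natCast.mpr (hp.dvd_choose_self n.succ_ne_zero hn)
    have h2 : p.choose (n + 1) = (p - 1).choose n + (p - 1).choose (n + 1) := by
      rw [← Nat.choose_succ_succ', Nat.sub_add_cancel hp.one_le]
    have h3 : ((p - 1).choose (n + 1) : ℤ) - (-1) ^ (n + 1) =
        (p.choose (n + 1) : ℤ) - (((p - 1).choose n : ℤ) - (-1) ^ n) := by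
      rw [h2]
      push_cast
      ring
    rw [h3]
    exact h1.sub (ih (by omega))

theorem choose_div_sub_mem_localMultiples {p : ℕ} (hp : p.Prime) {n : ℕ} (hn : n + 1 < p) :
    (p.choose (n + 1) : ℂ) / p - (-1) ^ n / ((n + 1 : ℕ) : ℂ) ∈ localMultiples hp := by
  obtain ⟨z, hz⟩ := dvd_choose_pred_sub hp (n := n) (by omega)
  have h1 : p * (p - 1).choose n = p.choose (n + 1) * (n + 1) := by
    have := Nat.add_one_mul_choose_eq (p - 1) n
    rwa [Nat.sub_add_cancel hp.one_le] at this
  have hp0 : (p : ℂ) ≠ 0 := by exact_mod_cast hp.ne_zero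
  have hn0 : ((n + 1 : ℕ) : ℂ) ≠ 0 := by exact_mod_cast n.succ_ne_zero
  refine mem_localMultiples.mpr ⟨z * ((n + 1 : ℕ) : ℂ)⁻¹, mul_mem (intCast_mem _ z)
    (inv_natCast_mem_localIntegers hp n.succ_pos hn), ?_⟩
  have h1' : (p : ℂ) * ((p - 1).choose n : ℂ) = p.choose (n + 1) * ((n + 1 : ℕ) : ℂ) := by
    exact_mod_cast h1
  have hz' : ((p - 1).choose n : ℂ) - (-1) ^ n = p * z := by exact_mod_cast hz
  field_simp
  linear_combination h1' - (p : ℂ) * hz'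

theorem gregory_succ (k : ℕ) : ((gregory (k + 1) : ℚ) : ℂ) = -∑ j : Fin (k + 1),
    ((gregory j : ℚ) : ℂ) * ((-1) ^ (k + 1 - (j : ℕ)) / ((k + 1 - (j : ℕ) + 1 : ℕ) : ℂ)) := by
  rw [gregory]
  push_cast
  congr 1
  refine Finset.sum_congr rfl fun j _ => ?_
  rw [show k + 2 - (j : ℕ) = k + 1 - (j : ℕ) + 1 by omega]
  push_cast
  ring

theorem neg_one_pow_div_mem_localIntegers {p : ℕ} (hp : p.Prime) {n : ℕ} (hn : n + 1 < p) :
    (-1) ^ n / ((n + 1 : ℕ) : ℂ) ∈ localIntegers hp := by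
  rw [div_eq_mul_inv]
  exact mul_mem (pow_mem (neg_mem (one_mem _)) n)
    (inv_natCast_mem_localIntegers hp n.succ_pos hn)

theorem gregory_mem_localIntegers {p : ℕ} (hp : p.Prime) (k : ℕ) (hk : k + 1 < p) :
    ((gregory k : ℚ) : ℂ) ∈ localIntegers hp := by
  induction k using Nat.strong_induction_on with
  | _ k ih =>
    rcases k with _ | k
    · simp [gregory, one_mem]
    · rw [gregory_succ]
      exact neg_mem (sum_mem fun j _ => mul_mem (ih j j.2 (by omega))
        (neg_one_pow_div_mem_localIntegers hp (by omega)))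

theorem coeff_rootSeries_sub_gregory_mem {p : ℕ} (hp : p.Prime) {ζ : ℂ}
    (hζ : IsPrimitiveRoot ζ p) (k : ℕ) (hk : k + 1 < p) :
    PowerSeries.coeff k (rootSeries ζ p) - ((gregory k : ℚ) : ℂ) ∈ localMultiples hp := by
  induction k using Nat.strong_induction_on with
  | _ k ih =>
    rcases k with _ | k
    · rw [coeff_zero_rootSeries]
      simp [gregory, zero_mem]
    · rw [coeff_succ_rootSeries hp.one_lt hζ, gregory_succ, ← neg_sub', ← Finset.sum_sub_distrib]
      exact neg_mem (sum_mem fun j _ => mul_sub_mul_mem_localMultiples (ih j j.2 (by omega))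
        (choose_div_sub_mem_localMultiples hp (by omega))
        (gregory_mem_localIntegers hp j (by omega))
        (neg_one_pow_div_mem_localIntegers hp (by omega)))

/-- For every `k ≥ 1`, for all sufficiently large primes `p` and every primitive `p`-th
root of unity `ζ_p`, the element `z_p(k; ζ_p) + G_k·(1-ζ_p)^k` lies in `p` times
`ℤ[ζ_p]` localized away from the denominator of `G_k`: there are `c ∈ ℤ` not divisible
by `p` and `w ∈ ℤ[ζ_p]` with `c·(z_p(k;ζ_p) + G_k·(1-ζ_p)^k) = p·w`, i.e.
`z_p(k;ζ_p) ≡ -G_k·(1-ζ_p)^k (mod p)`. -/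
theorem stmt_13 (k : ℕ) (hk : 1 ≤ k) :
    ∃ N : ℕ, ∀ p : ℕ, p.Prime → N < p → ∀ ζ : ℂ, IsPrimitiveRoot ζ p →
      ∃ c : ℤ, ¬ (p : ℤ) ∣ c ∧
        ∃ w ∈ Algebra.adjoin ℤ ({ζ} : Set ℂ),
          (c : ℂ) * (zq ζ [k] p + ((gregory k : ℚ) : ℂ) * (1 - ζ) ^ k) = p * w := by
  refine ⟨k + 1, fun p hp hpk ζ hζ => ?_⟩
  obtain ⟨u, ⟨c, hc, w, hw⟩, hu⟩ :=
    mem_localMultiples.mp (coeff_rootSeries_sub_gregory_mem hp hζ k hpk)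
  refine ⟨c, hc, -w * (1 - ζ) ^ k, ?_, ?_⟩
  · exact mul_mem (neg_mem (intCast_mem _ w))
      (pow_mem (sub_mem (one_mem _) (Algebra.self_mem_adjoin_singleton ℤ ζ)) k)
  · rw [zq_singleton_s13 ζ hk]
    linear_combination (c : ℂ) * (1 - ζ) ^ k * hu - (p : ℂ) * (1 - ζ) ^ k * hw
end

section
/- Let n ≥ 1 be an integer, q = e^{2πi/n}, and k = (k_1,…,k_r) an index of weight w = k_1+⋯+k_r. Then z_n(k_r,…,k_1; q) = (−q)^{w} · conj(z_n(k_1,…,k_r; q)) and z_n^⋆(k_r,…,k_1; q) = (−q)^{w} · conj(z_n^⋆(k_1,…,k_r; q)), where conj denotes complex conjugation. -/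
/-- The star finite multiple harmonic `q`-series
`z_n^⋆(k_1,…,k_r; q) = ∑_{n > m_1 ≥ ⋯ ≥ m_r > 0} ∏_j q^{(k_j-1)m_j}/[m_j]_q^{k_j}`. -/
noncomputable def zqStar (q : ℂ) : List ℕ → ℕ → ℂ
  | [], _ => 1
  | k :: ks, n => ∑ m ∈ Finset.Ioo 0 n, q ^ ((k - 1) * m) / qint q m ^ k * zqStar q ks (m + 1)

/-- Nested sums `∑ t k₁ m₁ ⋯ t k_r m_r` over `0 < m_j`, `m₁ < n`, `m_{j+1} < m_j + d`. -/
def descSum (t : ℕ → ℕ → ℂ) (d : ℕ) : List ℕ → ℕ → ℂ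
  | [], _ => 1
  | k :: ks, n => ∑ m ∈ Finset.Ioo 0 n, t k m * descSum t d ks (m + d)

/-- Nested sums `∑ t k₁ m₁ ⋯ t k_r m_r` over `m_j < n`, `p < m₁`, `m_j - d < m_{j+1}`. -/
def ascSum (t : ℕ → ℕ → ℂ) (d n : ℕ) : List ℕ → ℕ → ℂ
  | [], _ => 1
  | k :: ks, p => ∑ m ∈ Finset.Ioo p n, t k m * ascSum t d n ks (m - d)

theorem zq_eq_descSum (q : ℂ) (l : List ℕ) (n : ℕ) :
    zq q l n = descSum (fun k m => q ^ ((k - 1) * m) / qint q m ^ k) 0 l n := by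
  induction l generalizing n with
  | nil => rfl
  | cons k ks ih => simp only [zq, descSum, ih, add_zero]

theorem zqStar_eq_descSum (q : ℂ) (l : List ℕ) (n : ℕ) :
    zqStar q l n = descSum (fun k m => q ^ ((k - 1) * m) / qint q m ^ k) 1 l n := by
  induction l generalizing n with
  | nil => rfl
  | cons k ks ih => simp only [zqStar, descSum, ih]

theorem sum_descSum_mul_ascSum (t : ℕ → ℕ → ℂ) {d : ℕ} (hd : d ≤ 1) (n a : ℕ) (l l' : List ℕ) :
    ∑ m ∈ Finset.Ioo 0 n, t a m * descSum t d l (m + d) * ascSum t d n l' (m - d) =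
      ascSum t d n (l.reverse ++ a :: l') 0 := by
  induction l generalizing a l' with
  | nil => simp [descSum, ascSum]
  | cons b l ih =>
    rw [List.reverse_cons, List.append_assoc, List.singleton_append, ← ih]
    simp only [descSum, ascSum, Finset.mul_sum, Finset.sum_mul]
    rw [Finset.sum_comm' (t' := Finset.Ioo 0 n) (s' := fun m => Finset.Ioo (m - d) n)]
    · exact Finset.sum_congr rfl fun _ _ => Finset.sum_congr rfl fun _ _ => by ring
    · intro x y
      simp only [Finset.mem_Ioo]
      omega

theorem descSum_reverse (t : ℕ → ℕ → ℂ) {d : ℕ} (hd : d ≤ 1) (n : ℕ) (l : List ℕ) :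
    descSum t d l.reverse n = ascSum t d n l 0 := by
  rw [← l.reverse_reverse, List.reverse_reverse l.reverse]
  cases l.reverse with
  | nil => rfl
  | cons a l =>
    rw [List.reverse_cons, ← sum_descSum_mul_ascSum t hd]
    simp [descSum, ascSum]

theorem ascSum_eq_conj_descSum {t : ℕ → ℕ → ℂ} {c : ℂ} {d n : ℕ} (hd : d ≤ 1)
    (ht : ∀ k m, 0 < m → m < n → t k (n - m) = c ^ k * (starRingEnd ℂ) (t k m))
    (l : List ℕ) {p : ℕ} (hp : p ≤ n) :
    ascSum t d n l p = c ^ l.sum * (starRingEnd ℂ) (descSum t d l (n - p)) := by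
  induction l generalizing p with
  | nil => simp [ascSum, descSum]
  | cons k ks ih =>
    simp only [ascSum, descSum, map_sum, Finset.mul_sum, map_mul, List.sum_cons]
    refine Finset.sum_nbij' (fun m => n - m) (fun m => n - m) ?_ ?_ ?_ ?_ ?_
    · intro m hm
      simp only [Finset.mem_Ioo] at *
      omega
    · intro m hm
      simp only [Finset.mem_Ioo] at *
      omega
    · intro m hm
      simp only [Finset.mem_Ioo] at *
      omega
    · intro m hm
      simp only [Finset.mem_Ioo] at *
      omega
    · intro m hm
      rw [Finset.mem_Ioo] at hm
      have h := ht k (n - m) (by omega) (by omega)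
      rw [show n - (n - m) = m by omega] at h
      rw [ih (by omega), h, show n - (m - d) = n - m + d by omega]
      ring

theorem descSum_reverse_eq_conj {t : ℕ → ℕ → ℂ} {c : ℂ} {d n : ℕ} (hd : d ≤ 1)
    (ht : ∀ k m, 0 < m → m < n → t k (n - m) = c ^ k * (starRingEnd ℂ) (t k m)) (l : List ℕ) :
    descSum t d l.reverse n = c ^ l.sum * (starRingEnd ℂ) (descSum t d l n) := by
  rw [descSum_reverse t hd, ascSum_eq_conj_descSum hd ht l n.zero_le, Nat.sub_zero]

theorem qint_sub_eq_conj {q : ℂ} {n m : ℕ} (hc : (starRingEnd ℂ) q = q⁻¹) (hq : q ^ n = 1)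
    (h0 : q ≠ 0) (hm : m ≤ n) : (starRingEnd ℂ) (qint q m) = -q * qint q (n - m) := by
  have h1 : 1 - q⁻¹ = -(1 - q) / q := by field_simp; ring
  simp only [qint, map_div₀, map_sub, map_one, map_pow, hc, pow_sub₀ q h0 hm, hq, one_mul, inv_pow,
    h1, div_div_eq_mul_div, div_neg]
  ring

theorem qint_weight_sub_eq_conj {q : ℂ} {n m : ℕ} (hc : (starRingEnd ℂ) q = q⁻¹) (hq : q ^ n = 1)
    (h0 : q ≠ 0) (hm : m ≤ n) (k : ℕ) :
    q ^ ((k - 1) * (n - m)) / qint q (n - m) ^ k =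
      (-q) ^ k * (starRingEnd ℂ) (q ^ ((k - 1) * m) / qint q m ^ k) := by
  rw [map_div₀, map_pow, map_pow, qint_sub_eq_conj hc hq h0 hm, hc, mul_pow, ← mul_div_assoc,
    mul_div_mul_left _ _ (pow_ne_zero k (neg_ne_zero.mpr h0)), mul_comm (k - 1), mul_comm (k - 1),
    pow_mul, pow_mul, pow_sub₀ q h0 hm, hq, one_mul, inv_pow, inv_pow,
    inv_pow]

/-- Reversal: for `q = e^{2πi/n}` and an index `k` of weight `w`,
`z_n(reverse k; q) = (-q)^w · conj(z_n(k; q))` and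
`z_n^⋆(reverse k; q) = (-q)^w · conj(z_n^⋆(k; q))`. -/
theorem stmt_14 (n : ℕ) (hn : 1 ≤ n) (q : ℂ)
    (hq : q = Complex.exp (2 * Real.pi * Complex.I / n))
    (k : List ℕ) (hk : ∀ i ∈ k, 0 < i) :
    zq q k.reverse n = (-q) ^ k.sum * (starRingEnd ℂ) (zq q k n) ∧
    zqStar q k.reverse n = (-q) ^ k.sum * (starRingEnd ℂ) (zqStar q k n) := by
  have h0 : q ≠ 0 := hq ▸ Complex.exp_ne_zero _
  have hqn : q ^ n = 1 := hq ▸ (Complex.isPrimitiveRoot_exp n (by omega)).pow_eq_one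
  have hc : (starRingEnd ℂ) q = q⁻¹ :=
    (Complex.inv_eq_conj (Complex.norm_eq_one_of_pow_eq_one hqn (by omega))).symm
  simp only [zq_eq_descSum, zqStar_eq_descSum]
  exact ⟨descSum_reverse_eq_conj zero_le_one
      (fun k m _ hm => qint_weight_sub_eq_conj hc hqn h0 hm.le k) _,
    descSum_reverse_eq_conj le_rfl
      (fun k m _ hm => qint_weight_sub_eq_conj hc hqn h0 hm.le k) _⟩
end

section
/- Let r ≥ 1 and let a_1,…,a_r, b_1,…,b_r be positive integers, and let k be the index [a_1,…,a_r;b_1,…,b_r] and k^∨ its Hoffman dual, which equals the reverse of the index [b_r,…,b_1;a_r,…,a_1]. Then the limits ξ^⋆(k) = lim_{n→∞} z_n^⋆(k; e^{2πi/n}) and ξ^⋆(k^∨) = lim_{n→∞} z_n^⋆(k^∨; e^{2πi/n}) exist and satisfy ξ^⋆(k^∨) = −conj(ξ^⋆(k)), where conj denotes complex conjugation. -/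
open Filter

/-- The index `[a_1,…,a_r; b_1,…,b_r]`, i.e.
`({1}^{a_1-1}, b_1+1, …, {1}^{a_{r-1}-1}, b_{r-1}+1, {1}^{a_r-1}, b_r)`. -/
def abIndex : List ℕ → List ℕ → List ℕ
  | [a], [b] => List.replicate (a - 1) 1 ++ [b]
  | a :: as, b :: bs => List.replicate (a - 1) 1 ++ [b + 1] ++ abIndex as bs
  | _, _ => []

/-- The Gaussian binomial coefficient, defined through the `q`-Pascal rule. -/
def gaussBinom (q : ℂ) : ℕ → ℕ → ℂ
  | _, 0 => 1
  | 0, _ + 1 => 0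
  | n + 1, m + 1 => gaussBinom q n m + q ^ (m + 1) * gaussBinom q n (m + 1)

@[simp] theorem gaussBinom_zero_right (q : ℂ) (n : ℕ) : gaussBinom q n 0 = 1 := by
  cases n <;> rfl

theorem gaussBinom_succ_succ (q : ℂ) (n m : ℕ) :
    gaussBinom q (n + 1) (m + 1) = gaussBinom q n m + q ^ (m + 1) * gaussBinom q n (m + 1) := rfl

theorem gaussBinom_eq_zero (q : ℂ) : ∀ {n m : ℕ}, n < m → gaussBinom q n m = 0
  | 0, m + 1, _ => rfl
  | n + 1, m + 1, h => by
    rw [gaussBinom_succ_succ, gaussBinom_eq_zero q (by omega : n < m),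
      gaussBinom_eq_zero q (by omega : n < m + 1)]
    simp

theorem gaussBinom_succ_right (q : ℂ) : ∀ n m : ℕ,
    q ^ m * (1 - q ^ (m + 1)) * gaussBinom q n (m + 1) = (q ^ m - q ^ n) * gaussBinom q n m
  | 0, 0 => by simp [gaussBinom]
  | 0, m + 1 => by simp [gaussBinom]
  | n + 1, 0 => by
    have h := gaussBinom_succ_right q n 0
    rw [gaussBinom_succ_succ]
    simp only [gaussBinom_zero_right] at h ⊢
    linear_combination q * h
  | n + 1, m + 1 => by
    have h := gaussBinom_succ_right q n m
    have h' := gaussBinom_succ_right q n (m + 1)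
    rw [gaussBinom_succ_succ, gaussBinom_succ_succ]
    linear_combination q * h + q ^ (m + 2) * h'

theorem gaussBinom_absorb (q : ℂ) (n m : ℕ) :
    (1 - q ^ (m + 1)) * gaussBinom q (n + 1) (m + 1) = (1 - q ^ (n + 1)) * gaussBinom q n m := by
  rw [gaussBinom_succ_succ]
  linear_combination q * gaussBinom_succ_right q n m

theorem gaussBinom_succ_succ' (q : ℂ) (n m : ℕ) :
    q ^ m * gaussBinom q (n + 1) (m + 1) =
      q ^ n * gaussBinom q n m + q ^ m * gaussBinom q n (m + 1) := by
  rw [gaussBinom_succ_succ]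
  linear_combination -gaussBinom_succ_right q n m

theorem gaussBinom_pred_of_pow_eq_one {q : ℂ} {n : ℕ} (hq : q ^ (n + 1) = 1)
    (hq' : ∀ m, 0 < m → m < n + 1 → q ^ m ≠ 1) :
    ∀ m ≤ n, (-1) ^ m * q ^ (m + 1).choose 2 * gaussBinom q n m = 1
  | 0, _ => by simp
  | m + 1, h => by
    have ih := gaussBinom_pred_of_pow_eq_one hq hq' m (by omega)
    have h1 := gaussBinom_absorb q n m
    rw [hq, sub_self, zero_mul, mul_eq_zero, gaussBinom_succ_succ] at h1
    have h2 := h1.resolve_left (sub_ne_zero.2 (hq' (m + 1) (by omega) (by omega)).symm)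
    have h3 : (m + 1 + 1).choose 2 = (m + 1) + (m + 1).choose 2 := by
      rw [Nat.choose_succ_succ (m + 1) 1]; simp
    rw [h3, pow_add q]
    linear_combination ih - (-1) ^ m * q ^ (m + 1).choose 2 * h2

/-- The signed `q`-binomial transform of a sequence indexed by positive integers;
`qTransform q a N` is the value at `N + 1`. -/
noncomputable def qTransform (q : ℂ) (a : ℕ → ℂ) (N : ℕ) : ℂ :=
  ∑ m ∈ Finset.range (N + 1), (-1) ^ m * q ^ (m + 1).choose 2 * gaussBinom q N m * a (m + 1)

theorem sum_pow_mul_qTransform (q : ℂ) (a : ℕ → ℂ) (N : ℕ) :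
    ∑ j ∈ Finset.range N, q ^ (j + 1) * qTransform q a j =
      ∑ m ∈ Finset.range N,
        (-1) ^ m * q ^ (m + 1).choose 2 * q ^ (m + 1) * gaussBinom q N (m + 1) * a (m + 1) := by
  induction N with
  | zero => simp
  | succ N ih =>
    rw [Finset.sum_range_succ, ih, qTransform, Finset.mul_sum]
    have : ∑ m ∈ Finset.range N,
        (-1) ^ m * q ^ (m + 1).choose 2 * q ^ (m + 1) * gaussBinom q N (m + 1) * a (m + 1) =
        ∑ m ∈ Finset.range (N + 1),
        (-1) ^ m * q ^ (m + 1).choose 2 * q ^ (m + 1) * gaussBinom q N (m + 1) * a (m + 1) := by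
      rw [Finset.sum_range_succ, gaussBinom_eq_zero q (Nat.lt_succ_self N)]
      simp
    rw [this, ← Finset.sum_add_distrib]
    refine Finset.sum_congr rfl fun m _ => ?_
    linear_combination
      -((-1) ^ m * q ^ (m + 1).choose 2 * q * a (m + 1)) * gaussBinom_succ_succ' q N m

theorem gaussBinom_div_qint {q : ℂ} {n m N : ℕ} (hq : ∀ m, 0 < m → m < n → q ^ m ≠ 1)
    (hN : N + 1 < n) (hm : m ≤ N) :
    gaussBinom q N m / qint q (m + 1) = gaussBinom q (N + 1) (m + 1) / qint q (N + 1) := by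
  have h1 : 1 - q ≠ 0 := sub_ne_zero.2 (by simpa using (hq 1 one_pos (by omega)).symm)
  have h2 : 1 - q ^ (m + 1) ≠ 0 := sub_ne_zero.2 (hq _ (by omega) (by omega)).symm
  have h3 : 1 - q ^ (N + 1) ≠ 0 := sub_ne_zero.2 (hq _ (by omega) (by omega)).symm
  simp only [qint]
  field_simp
  linear_combination -gaussBinom_absorb q N m

theorem qTransform_div_qint {q : ℂ} {n N : ℕ} (hq : ∀ m, 0 < m → m < n → q ^ m ≠ 1)
    (hN : N + 1 < n) (a : ℕ → ℂ) :
    qTransform q (fun m => a m / qint q m) N =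
      (∑ m ∈ Finset.range (N + 1),
        (-1) ^ m * q ^ (m + 1).choose 2 * gaussBinom q (N + 1) (m + 1) * a (m + 1)) /
        qint q (N + 1) := by
  rw [qTransform, Finset.sum_div]
  refine Finset.sum_congr rfl fun m hm => ?_
  have := gaussBinom_div_qint hq hN (Nat.lt_succ_iff.1 (Finset.mem_range.1 hm))
  linear_combination (-1) ^ m * q ^ (m + 1).choose 2 * a (m + 1) * this

theorem qTransform_pow_mul_div_qint {q : ℂ} {n N : ℕ} (hq : ∀ m, 0 < m → m < n → q ^ m ≠ 1)
    (hN : N + 1 < n) (a : ℕ → ℂ) :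
    qTransform q (fun m => q ^ m * a m / qint q m) N =
      (∑ j ∈ Finset.range (N + 1), q ^ (j + 1) * qTransform q a j) / qint q (N + 1) := by
  rw [qTransform_div_qint hq hN fun m => q ^ m * a m, sum_pow_mul_qTransform]
  congr 1
  exact Finset.sum_congr rfl fun m _ => by ring

theorem sum_sub_mul_sum_range (u a : ℕ → ℂ) (K : ℕ) :
    ∑ m ∈ Finset.range K, (u m - u (m + 1)) * ∑ j ∈ Finset.range (m + 1), a j =
      ∑ m ∈ Finset.range K, u m * a m - u K * ∑ j ∈ Finset.range K, a j := by
  induction K with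
  | zero => simp
  | succ K ih =>
    rw [Finset.sum_range_succ, ih, Finset.sum_range_succ _ K, Finset.sum_range_succ _ K]
    ring

theorem sum_gaussBinom_mul_sum (q : ℂ) (N : ℕ) (a : ℕ → ℂ) :
    ∑ m ∈ Finset.range (N + 1), (-1) ^ m * q ^ (m + 1).choose 2 * gaussBinom q (N + 1) (m + 1) *
      ∑ j ∈ Finset.range (m + 1), a (j + 1) = qTransform q a N := by
  have h := sum_sub_mul_sum_range (fun m => (-1) ^ m * q ^ (m + 1).choose 2 * gaussBinom q N m)
    (fun m => a (m + 1)) (N + 1)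
  simp only [gaussBinom_eq_zero q (Nat.lt_succ_self N), mul_zero, zero_mul, sub_zero] at h
  rw [qTransform, ← h]
  refine Finset.sum_congr rfl fun m _ => ?_
  have h3 : (m + 1 + 1).choose 2 = (m + 1) + (m + 1).choose 2 := by
    rw [Nat.choose_succ_succ (m + 1) 1]; simp
  rw [h3, gaussBinom_succ_succ]
  ring

/-- The inductive description of Hoffman duality between indices. -/
inductive HoffmanDual : List ℕ → List ℕ → Prop
  | one : HoffmanDual [1] [1]
  | raise {c : ℕ} {k k' : List ℕ} :
      HoffmanDual (c :: k) k' → HoffmanDual ((c + 1) :: k) (1 :: k')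
  | extend {d : ℕ} {k k' : List ℕ} :
      HoffmanDual k (d :: k') → HoffmanDual (1 :: k) ((d + 1) :: k')

theorem HoffmanDual.symm {k k' : List ℕ} (h : HoffmanDual k k') : HoffmanDual k' k := by
  induction h with
  | one => exact .one
  | raise _ ih => exact .extend ih
  | extend _ ih => exact .raise ih

theorem HoffmanDual.ne_nil {k k' : List ℕ} (h : HoffmanDual k k') : k ≠ [] := by
  cases h <;> simp

theorem HoffmanDual.pos {k k' : List ℕ} (h : HoffmanDual k k') : ∀ c ∈ k, 0 < c := by
  induction h with
  | one => simp
  | raise _ ih => simp only [List.mem_cons, forall_eq_or_imp] at ih ⊢; exact ⟨by omega, ih.2⟩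
  | extend _ ih => simp only [List.mem_cons, forall_eq_or_imp]; exact ⟨one_pos, ih⟩

/-- The part of `zqStar q k` whose largest summation variable equals `m`. -/
noncomputable def zqStarTop (q : ℂ) : List ℕ → ℕ → ℂ
  | [], _ => 0
  | c :: k, m => q ^ ((c - 1) * m) / qint q m ^ c * zqStar q k (m + 1)

theorem sum_Ioo_zero_succ (f : ℕ → ℂ) (n : ℕ) :
    ∑ m ∈ Finset.Ioo 0 (n + 1), f m = ∑ m ∈ Finset.range n, f (m + 1) := by
  rw [Finset.range_eq_Ico, Finset.sum_Ico_add' f 0 n 1]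
  rfl

theorem zqStar_succ (q : ℂ) {k : List ℕ} (hk : k ≠ []) (n : ℕ) :
    zqStar q k (n + 1) = ∑ m ∈ Finset.range n, zqStarTop q k (m + 1) := by
  cases k with
  | nil => exact absurd rfl hk
  | cons c k => rw [zqStar, sum_Ioo_zero_succ]; rfl

theorem zqStarTop_raise (q : ℂ) {c : ℕ} (hc : 0 < c) (k : List ℕ) (m : ℕ) :
    zqStarTop q ((c + 1) :: k) m = q ^ m * zqStarTop q (c :: k) m / qint q m := by
  obtain ⟨c, rfl⟩ := Nat.exists_eq_succ_of_ne_zero hc.ne'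
  simp only [zqStarTop, Nat.succ_eq_add_one, Nat.add_sub_cancel, div_eq_mul_inv]
  ring

theorem zqStarTop_one_cons (q : ℂ) {k : List ℕ} (hk : k ≠ []) (m : ℕ) :
    zqStarTop q (1 :: k) m = (∑ j ∈ Finset.range m, zqStarTop q k (j + 1)) / qint q m := by
  rw [zqStarTop, zqStar_succ q hk]
  simp [div_eq_mul_inv, mul_comm]

theorem qint_inv {q : ℂ} (h0 : q ≠ 0) (m : ℕ) :
    qint q⁻¹ (m + 1) = qint q (m + 1) / q ^ m := by
  by_cases h : q = 1
  · simp [h, qint]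
  have h1 : 1 - q ≠ 0 := sub_ne_zero.2 (Ne.symm h)
  have h2 : 1 - q⁻¹ ≠ 0 := sub_ne_zero.2 (fun h2 => h (inv_eq_one.1 h2.symm))
  simp only [qint]
  rw [div_div, div_eq_div_iff h2 (mul_ne_zero h1 (pow_ne_zero _ h0))]
  rw [inv_pow, pow_succ]
  field_simp
  ring

theorem HoffmanDual.qTransform_zqStarTop {q : ℂ} {n : ℕ} (h0 : q ≠ 0)
    (hq : ∀ m, 0 < m → m < n → q ^ m ≠ 1) {k k' : List ℕ} (h : HoffmanDual k k') :
    ∀ N, N + 1 < n →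
      q ^ (N + 1) * qTransform q (zqStarTop q k) N = q ^ k.sum * zqStarTop q⁻¹ k' (N + 1) := by
  have key : ∀ N, (qint q⁻¹ (N + 1))⁻¹ = q ^ N / qint q (N + 1) := fun N => by
    rw [qint_inv h0, inv_div]
  induction h with
  | one =>
    intro N hN
    have h1 : qTransform q (zqStarTop q [1]) N =
        qTransform q (fun m => (∑ j ∈ Finset.range m, if j + 1 = 1 then (1 : ℂ) else 0) /
          qint q m) N := by
      refine Finset.sum_congr rfl fun m _ => ?_
      simp [zqStarTop, zqStar]
    have h2 : qTransform q (fun m => if m = 1 then (1 : ℂ) else 0) N = 1 := by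
      simp [qTransform]
    rw [h1, qTransform_div_qint hq hN, sum_gaussBinom_mul_sum q N fun m => if m = 1 then 1 else 0,
      h2]
    simp [zqStarTop, zqStar, key, pow_succ, div_eq_mul_inv]
    ring
  | @raise c k k' h ih =>
    intro N hN
    have hc : 0 < c := h.pos c (by simp)
    have hk' : k' ≠ [] := h.symm.ne_nil
    rw [show zqStarTop q ((c + 1) :: k) = fun m => q ^ m * zqStarTop q (c :: k) m / qint q m from
      funext fun m => zqStarTop_raise q hc k m, qTransform_pow_mul_div_qint hq hN,
      zqStarTop_one_cons _ hk', div_eq_mul_inv _ (qint q⁻¹ _), key]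
    rw [Finset.sum_congr rfl fun j hj => ih j (by have := Finset.mem_range.1 hj; omega),
      ← Finset.mul_sum]
    simp only [List.sum_cons]
    ring
  | @extend d k k' h ih =>
    intro N hN
    have hd : 0 < d := h.symm.pos d (by simp)
    have hk : k ≠ [] := h.ne_nil
    rw [show zqStarTop q (1 :: k) = fun m =>
        (∑ j ∈ Finset.range m, zqStarTop q k (j + 1)) / qint q m from
      funext fun m => zqStarTop_one_cons q hk m, qTransform_div_qint hq hN,
      sum_gaussBinom_mul_sum, zqStarTop_raise _ hd, div_eq_mul_inv _ (qint q⁻¹ _), key,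
      List.sum_cons, ← mul_div_assoc, ih N hN]
    have : q⁻¹ ^ (N + 1) * q ^ N * q = 1 := by rw [mul_assoc, ← pow_succ, ← mul_pow]; simp [h0]
    linear_combination -(q ^ k.sum * zqStarTop q⁻¹ (d :: k') (N + 1) / qint q (N + 1)) * this

theorem HoffmanDual.zqStar_inv {q : ℂ} {n : ℕ} (hn : 0 < n) (hq1 : q ^ n = 1)
    (hq : ∀ m, 0 < m → m < n → q ^ m ≠ 1) {k k' : List ℕ} (h : HoffmanDual k k') :
    q ^ k.sum * zqStar q⁻¹ k' n = -zqStar q k n := by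
  obtain ⟨n, rfl⟩ := Nat.exists_eq_succ_of_ne_zero hn.ne'
  have h0 : q ≠ 0 := by rintro rfl; simp at hq1
  have hk : k ≠ [] := h.ne_nil
  have hk' : k' ≠ [] := h.symm.ne_nil
  rw [Nat.succ_eq_add_one, zqStar_succ _ hk, zqStar_succ _ hk', Finset.mul_sum,
    ← Finset.sum_congr rfl fun N hN => h.qTransform_zqStarTop h0 hq N
      (by have := Finset.mem_range.1 hN; omega),
    sum_pow_mul_qTransform, ← Finset.sum_neg_distrib]
  refine Finset.sum_congr rfl fun m hm => ?_
  have h2 := gaussBinom_pred_of_pow_eq_one hq1 hq (m + 1) (Finset.mem_range.1 hm)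
  have h3 : (m + 1 + 1).choose 2 = (m + 1) + (m + 1).choose 2 := by
    rw [Nat.choose_succ_succ (m + 1) 1]; simp
  rw [h3, pow_add q] at h2
  linear_combination -zqStarTop q k (m + 1) * h2

theorem zqStar_conj (q : ℂ) : ∀ (k : List ℕ) (n : ℕ),
    (starRingEnd ℂ) (zqStar q k n) = zqStar ((starRingEnd ℂ) q) k n
  | [], n => by simp [zqStar]
  | c :: k, n => by simp [zqStar, qint, zqStar_conj q k]

/-- Increase the first entry of a list by one. -/
def incHead : List ℕ → List ℕ
  | [] => []
  | d :: l => (d + 1) :: l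

theorem incHead_append {l : List ℕ} (hl : l ≠ []) (l' : List ℕ) :
    incHead (l ++ l') = incHead l ++ l' := by
  cases l with
  | nil => exact absurd rfl hl
  | cons d l => rfl

theorem abIndex_ne_nil : ∀ {a b : List ℕ}, a ≠ [] → a.length = b.length → abIndex a b ≠ []
  | [_], [_], _, _ => by simp [abIndex]
  | _ :: _ :: _, _ :: _ :: _, _, _ => by simp [abIndex]

theorem abIndex_cons (x y : ℕ) {a b : List ℕ} (ha : a ≠ []) :
    abIndex (x :: a) (y :: b) = List.replicate (x - 1) 1 ++ [y + 1] ++ abIndex a b := by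
  cases a with
  | nil => exact absurd rfl ha
  | cons _ _ => rw [abIndex]; simp

theorem reverse_abIndex_append_singleton (x y : ℕ) : ∀ {a b : List ℕ}, a ≠ [] →
    a.length = b.length → (abIndex (a ++ [x]) (b ++ [y])).reverse =
      y :: (List.replicate (x - 1) 1 ++ incHead (abIndex a b).reverse)
  | [u], [v], _, _ => by simp [abIndex, incHead]
  | u :: u' :: a, v :: v' :: b, _, h => by
    have ih := reverse_abIndex_append_singleton x y (a := u' :: a) (b := v' :: b) (by simp)
      (by simpa using h)
    have hne : (abIndex (u' :: a) (v' :: b)).reverse ≠ [] := by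
      simpa using abIndex_ne_nil (a := u' :: a) (b := v' :: b) (by simp) (by simpa using h)
    rw [List.cons_append (a := u), List.cons_append (a := v), abIndex_cons u v (by simp),
      List.reverse_append, ih, abIndex_cons u v (by simp),
      List.reverse_append (bs := abIndex (u' :: a) (v' :: b)), incHead_append hne]
    simp

theorem HoffmanDual.extend_replicate {k k' : List ℕ} {d : ℕ} (h : HoffmanDual k (d :: k')) :
    ∀ n : ℕ, HoffmanDual (List.replicate n 1 ++ k) ((d + n) :: k')
  | 0 => h
  | n + 1 => by
    rw [List.replicate_succ, List.cons_append]
    exact .extend (h.extend_replicate n)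

theorem HoffmanDual.raise_replicate {k k' : List ℕ} {c : ℕ} (h : HoffmanDual (c :: k) k')
    (n : ℕ) : HoffmanDual ((c + n) :: k) (List.replicate n 1 ++ k') :=
  (h.symm.extend_replicate n).symm

theorem hoffmanDual_abIndex : ∀ {a b : List ℕ}, a ≠ [] → a.length = b.length →
    (∀ i ∈ a, 0 < i) → (∀ i ∈ b, 0 < i) →
    HoffmanDual (abIndex a b) (abIndex b.reverse a.reverse).reverse
  | [x], [y], _, _, hx, hy => by
    obtain ⟨x, rfl⟩ := Nat.exists_eq_add_of_lt (hx x (by simp))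
    obtain ⟨y, rfl⟩ := Nat.exists_eq_add_of_lt (hy y (by simp))
    have := (HoffmanDual.one.raise_replicate y)
    rw [← List.replicate_succ', List.replicate_succ] at this
    have := this.extend_replicate x
    simpa [abIndex, add_comm] using this
  | x :: x' :: a, y :: y' :: b, _, h, hx, hy => by
    have ih := hoffmanDual_abIndex (a := x' :: a) (b := y' :: b) (by simp) (by simpa using h)
      (fun i hi => hx i (List.mem_cons_of_mem _ hi)) (fun i hi => hy i (List.mem_cons_of_mem _ hi))
    rw [List.reverse_cons (a := x), List.reverse_cons (a := y),
      reverse_abIndex_append_singleton _ _ (by simp) (by simpa using h.symm),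
      abIndex_cons _ _ (by simp)]
    generalize (abIndex (y' :: b).reverse (x' :: a).reverse).reverse = l at ih
    obtain ⟨x, rfl⟩ := Nat.exists_eq_add_of_lt (hx x (by simp))
    obtain ⟨y, rfl⟩ := Nat.exists_eq_add_of_lt (hy y (by simp))
    cases l with
    | nil => exact absurd rfl ih.symm.ne_nil
    | cons d l =>
      have h1 := (HoffmanDual.extend ih).raise_replicate (y + 1)
      rw [List.replicate_succ, List.cons_append] at h1
      have := h1.extend_replicate x
      simpa [incHead, add_comm, add_left_comm] using this
/-- For a family `f n m` (thought of on `0 < m < n`), a bound by the power `s` of the distance of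
`m` to `{0, n}`, uniformly in `n`. -/
def EndBounded (s : ℝ) (f : ℕ → ℕ → ℂ) : Prop :=
  ∃ C : ℝ, 0 ≤ C ∧ ∀ n m : ℕ, 0 < m → m < n → ‖f n m‖ ≤ C * ((min m (n - m) : ℕ) : ℝ) ^ s

/-- The family `f n m` converges as `n → ∞` at a fixed distance from either end of `0 < m < n`. -/
structure EndLimits (f : ℕ → ℕ → ℂ) : Prop where
  low : ∀ m, 0 < m → ∃ L, Tendsto (fun n => f n m) atTop (nhds L)
  high : ∀ l, 0 < l → ∃ L, Tendsto (fun n => f n (n - l)) atTop (nhds L)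

theorem one_le_min_sub {n m : ℕ} (h0 : 0 < m) (h1 : m < n) :
    (1 : ℝ) ≤ ((min m (n - m) : ℕ) : ℝ) := by
  exact_mod_cast (by omega : 1 ≤ min m (n - m))

namespace EndBounded

variable {s t : ℝ} {f g : ℕ → ℕ → ℂ}

theorem mono (h : EndBounded s f) (hst : s ≤ t) : EndBounded t f := by
  obtain ⟨C, hC, h⟩ := h
  refine ⟨C, hC, fun n m h0 h1 => (h n m h0 h1).trans ?_⟩
  have := one_le_min_sub h0 h1
  gcongr

theorem const (c : ℂ) : EndBounded 0 (fun _ _ => c) :=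
  ⟨‖c‖, norm_nonneg _, fun n m _ _ => by simp⟩

theorem add (hf : EndBounded s f) (hg : EndBounded s g) : EndBounded s (f + g) := by
  obtain ⟨C, hC, hf⟩ := hf
  obtain ⟨D, hD, hg⟩ := hg
  refine ⟨C + D, by positivity, fun n m h0 h1 => ?_⟩
  rw [add_mul]
  exact (norm_add_le _ _).trans (add_le_add (hf n m h0 h1) (hg n m h0 h1))

theorem mul (hf : EndBounded s f) (hg : EndBounded t g) : EndBounded (s + t) (f * g) := by
  obtain ⟨C, hC, hf⟩ := hf
  obtain ⟨D, hD, hg⟩ := hg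
  refine ⟨C * D, by positivity, fun n m h0 h1 => ?_⟩
  have h2 := one_le_min_sub h0 h1
  rw [Real.rpow_add (by positivity), Pi.mul_apply, Pi.mul_apply, norm_mul]
  calc _ ≤ (C * ((min m (n - m) : ℕ) : ℝ) ^ s) * (D * ((min m (n - m) : ℕ) : ℝ) ^ t) :=
        mul_le_mul (hf n m h0 h1) (hg n m h0 h1) (norm_nonneg _) (by positivity)
    _ = _ := by ring

theorem pow (hf : EndBounded s f) (p : ℕ) : EndBounded (p * s) (f ^ p) := by
  induction p with
  | zero =>
    simp only [pow_zero, Nat.cast_zero, zero_mul]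
    exact const 1
  | succ p ih =>
    have := ih.mul hf
    rw [← pow_succ] at this
    convert this using 1
    push_cast
    ring

end EndBounded

namespace EndLimits

variable {f g : ℕ → ℕ → ℂ}

theorem const (c : ℂ) : EndLimits (fun _ _ => c) :=
  ⟨fun _ _ => ⟨c, tendsto_const_nhds⟩, fun _ _ => ⟨c, tendsto_const_nhds⟩⟩

theorem add (hf : EndLimits f) (hg : EndLimits g) : EndLimits (f + g) where
  low m hm := by
    obtain ⟨L, hL⟩ := hf.low m hm
    obtain ⟨M, hM⟩ := hg.low m hm
    exact ⟨_, hL.add hM⟩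
  high m hm := by
    obtain ⟨L, hL⟩ := hf.high m hm
    obtain ⟨M, hM⟩ := hg.high m hm
    exact ⟨_, hL.add hM⟩

theorem mul (hf : EndLimits f) (hg : EndLimits g) : EndLimits (f * g) where
  low m hm := by
    obtain ⟨L, hL⟩ := hf.low m hm
    obtain ⟨M, hM⟩ := hg.low m hm
    exact ⟨_, hL.mul hM⟩
  high m hm := by
    obtain ⟨L, hL⟩ := hf.high m hm
    obtain ⟨M, hM⟩ := hg.high m hm
    exact ⟨_, hL.mul hM⟩

theorem pow (hf : EndLimits f) (p : ℕ) : EndLimits (f ^ p) := by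
  induction p with
  | zero => rw [pow_zero]; exact const 1
  | succ p ih => rw [pow_succ]; exact ih.mul hf

end EndLimits

/-- A family with limits at both ends that grows slower than any power. -/
structure Moderate (f : ℕ → ℕ → ℂ) : Prop where
  bound : ∀ ε : ℝ, 0 < ε → EndBounded ε f
  limits : EndLimits f

/-- A family with limits at both ends whose sums converge absolutely. -/
structure EndSummable (f : ℕ → ℕ → ℂ) : Prop where
  bound : ∃ s : ℝ, s < -(3 / 2) ∧ EndBounded s f
  limits : EndLimits f

namespace Moderate

variable {f g : ℕ → ℕ → ℂ}

theorem const (c : ℂ) : Moderate (fun _ _ => c) :=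
  ⟨fun _ h => (EndBounded.const c).mono h.le, .const c⟩

theorem add (hf : Moderate f) (hg : Moderate g) : Moderate (f + g) :=
  ⟨fun ε h => (hf.bound ε h).add (hg.bound ε h), hf.limits.add hg.limits⟩

theorem mul (hf : Moderate f) (hg : Moderate g) : Moderate (f * g) :=
  ⟨fun ε h => by
    simpa using (hf.bound (ε / 2) (half_pos h)).mul (hg.bound (ε / 2) (half_pos h)),
    hf.limits.mul hg.limits⟩

theorem neg (hf : Moderate f) : Moderate (-f) := by
  have := (const (-1)).mul hf
  convert this using 1
  ext n m
  simp

theorem sum {ι : Type*} (s : Finset ι) {F : ι → ℕ → ℕ → ℂ} (h : ∀ i ∈ s, Moderate (F i)) :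
    Moderate (∑ i ∈ s, F i) :=
  Finset.sum_induction _ _ (fun _ _ => add) (const 0) h

end Moderate

theorem tendsto_sum_range_of_dominated {g : ℕ → ℕ → ℂ} {K : ℕ → ℕ} {b : ℕ → ℝ}
    (hK : Tendsto K atTop atTop) (hb : Summable b) (hb0 : ∀ m, 0 ≤ b m)
    (hgb : ∀ n, ∀ m < K n, ‖g n m‖ ≤ b m) (hg : ∀ m, ∃ L, Tendsto (fun n => g n m) atTop (nhds L)) :
    ∃ L, Tendsto (fun n => ∑ m ∈ Finset.range (K n), g n m) atTop (nhds L) := by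
  choose L hL using hg
  refine ⟨∑' m, L m, ?_⟩
  have h := tendsto_tsum_of_dominated_convergence (𝓕 := atTop)
    (f := fun n m => if m < K n then g n m else 0) (g := L) hb
    (fun m => (hL m).congr' ?_) (Eventually.of_forall fun n m => ?_)
  · refine h.congr fun n => ?_
    rw [tsum_eq_sum (s := Finset.range (K n)) fun m hm => if_neg (by simpa using hm)]
    exact Finset.sum_congr rfl fun m hm => if_pos (Finset.mem_range.1 hm)
  · filter_upwards [hK.eventually_gt_atTop m] with n hn
    rw [if_pos hn]
  · split_ifs with hm
    · exact hgb n m hm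
    · simpa using hb0 m

/-- Partial sums, in the second argument, of a family of sequences on the positive integers. -/
def partialSum (f : ℕ → ℕ → ℂ) (n M : ℕ) : ℂ := ∑ m ∈ Finset.range M, f n (m + 1)

theorem partialSum_succ (f : ℕ → ℕ → ℂ) (n M : ℕ) :
    partialSum f n (M + 1) = partialSum f n M + f n (M + 1) := Finset.sum_range_succ _ _

@[simp] theorem partialSum_zero (f : ℕ → ℕ → ℂ) (n : ℕ) : partialSum f n 0 = 0 := rfl

theorem partialSum_add (f g : ℕ → ℕ → ℂ) :
    partialSum (f + g) = partialSum f + partialSum g := by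
  ext n M
  simp [partialSum, Finset.sum_add_distrib]

theorem partialSum_neg (f : ℕ → ℕ → ℂ) : partialSum (-f) = -partialSum f := by
  ext n M
  simp [partialSum]

theorem partialSum_pred (f : ℕ → ℕ → ℂ) {n M : ℕ} (h : M < n) :
    partialSum f n (n - 1) =
      partialSum f n M + ∑ j ∈ Finset.range (n - 1 - M), f n (n - (j + 1)) := by
  have h1 : n - 1 = M + (n - 1 - M) := by omega
  conv_lhs => rw [partialSum, h1, Finset.sum_range_add]
  rw [partialSum]
  congr 1
  rw [← Finset.sum_range_reflect]
  refine Finset.sum_congr rfl fun j hj => ?_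
  have := Finset.mem_range.1 hj
  congr 1
  omega

theorem EndLimits.partialSum {f : ℕ → ℕ → ℂ} (hf : EndLimits f)
    (h : ∃ L, Tendsto (fun n => partialSum f n (n - 1)) atTop (nhds L)) :
    EndLimits (partialSum f) where
  low m _ := by
    choose L hL using fun i => hf.low (i + 1) i.succ_pos
    exact ⟨_, tendsto_finsetSum _ fun i _ => hL i⟩
  high l hl := by
    induction l, hl using Nat.le_induction with
    | base => exact h
    | succ l hl ih =>
      obtain ⟨L, hL⟩ := ih
      obtain ⟨M, hM⟩ := hf.high l hl
      refine ⟨L - M, (hL.sub hM).congr' ?_⟩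
      filter_upwards [eventually_gt_atTop l] with n hn
      have h1 : n - l = n - (l + 1) + 1 := by omega
      rw [h1, partialSum_succ]
      ring

theorem summable_succ_rpow : Summable fun m : ℕ => ((m + 1 : ℕ) : ℝ) ^ (-(3 / 2) : ℝ) :=
  (summable_nat_add_iff 1).2 (Real.summable_nat_rpow.2 (by norm_num))

theorem EndSummable.partialSum {f : ℕ → ℕ → ℂ} (hf : EndSummable f) :
    Moderate (partialSum f) := by
  obtain ⟨⟨s, hs, hb⟩, hl⟩ := hf
  obtain ⟨C, hC, hb⟩ := hb.mono hs.le
  have hs := summable_succ_rpow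
  have hlow : ∀ n m : ℕ, m < n / 2 → ‖f n (m + 1)‖ ≤ C * ((m + 1 : ℕ) : ℝ) ^ (-(3 / 2) : ℝ) := by
    intro n m hm
    have := hb n (m + 1) (by omega) (by omega)
    rwa [show min (m + 1) (n - (m + 1)) = m + 1 by omega] at this
  have hhigh : ∀ n m : ℕ, m < n - 1 - n / 2 →
      ‖f n (n - (m + 1))‖ ≤ C * ((m + 1 : ℕ) : ℝ) ^ (-(3 / 2) : ℝ) := by
    intro n m hm
    have := hb n (n - (m + 1)) (by omega) (by omega)
    rwa [show min (n - (m + 1)) (n - (n - (m + 1))) = m + 1 by omega] at this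
  refine ⟨fun ε hε => ?_, hl.partialSum ?_⟩
  · refine EndBounded.mono (s := 0) ?_ hε.le
    refine ⟨C * (2 * ∑' m : ℕ, ((m + 1 : ℕ) : ℝ) ^ (-(3 / 2) : ℝ)), ?_, fun n M h0 h1 => ?_⟩
    · have : 0 ≤ ∑' m : ℕ, ((m + 1 : ℕ) : ℝ) ^ (-(3 / 2) : ℝ) := tsum_nonneg fun m => by positivity
      positivity
    rw [Real.rpow_zero, mul_one]
    calc ‖_root_.partialSum f n M‖ ≤ ∑ m ∈ Finset.range M, ‖f n (m + 1)‖ := norm_sum_le _ _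
      _ ≤ ∑ m ∈ Finset.range (n - 1), ‖f n (m + 1)‖ :=
        Finset.sum_le_sum_of_subset_of_nonneg (Finset.range_mono (by omega))
          fun _ _ _ => norm_nonneg _
      _ ≤ ∑ m ∈ Finset.range (n - 1), (C * ((m + 1 : ℕ) : ℝ) ^ (-(3 / 2) : ℝ) +
            C * ((n - 1 - 1 - m + 1 : ℕ) : ℝ) ^ (-(3 / 2) : ℝ)) := by
        refine Finset.sum_le_sum fun m hm => (hb n (m + 1) (by omega)
          (by have := Finset.mem_range.1 hm; omega)).trans ?_
        have hm := Finset.mem_range.1 hm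
        rw [show n - 1 - 1 - m + 1 = n - (m + 1) by omega]
        rcases min_choice (m + 1) (n - (m + 1)) with h | h <;> rw [h]
        · exact le_add_of_nonneg_right (by positivity)
        · exact le_add_of_nonneg_left (by positivity)
      _ = C * (2 * ∑ m ∈ Finset.range (n - 1), ((m + 1 : ℕ) : ℝ) ^ (-(3 / 2) : ℝ)) := by
        rw [Finset.sum_add_distrib, Finset.sum_range_reflect
          (fun m => C * ((m + 1 : ℕ) : ℝ) ^ (-(3 / 2) : ℝ)), ← Finset.mul_sum]
        ring
      _ ≤ _ := by
        gcongr
        exact hs.sum_le_tsum _ fun m _ => by positivity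
  · have hK : Tendsto (fun n : ℕ => n / 2) atTop atTop :=
      Nat.tendsto_div_const_atTop two_ne_zero
    have hK' : Tendsto (fun n : ℕ => n - 1 - n / 2) atTop atTop :=
      tendsto_atTop_mono (fun n => (by omega : (n - 1) / 2 ≤ n - 1 - n / 2))
        ((Nat.tendsto_div_const_atTop two_ne_zero).comp (tendsto_sub_atTop_nat 1))
    obtain ⟨L, hL⟩ := tendsto_sum_range_of_dominated (g := fun n m => f n (m + 1)) hK
      (hs.mul_left C) (fun m => by positivity) hlow fun m => hl.low (m + 1) m.succ_pos
    obtain ⟨L', hL'⟩ := tendsto_sum_range_of_dominated (g := fun n m => f n (n - (m + 1))) hK'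
      (hs.mul_left C) (fun m => by positivity) hhigh fun m => hl.high (m + 1) m.succ_pos
    refine ⟨L + L', (hL.add hL').congr' ?_⟩
    filter_upwards [eventually_gt_atTop 0] with n hn
    rw [partialSum_pred f (Nat.div_lt_self hn one_lt_two)]
    rfl

theorem EndSummable.mul_moderate {f g : ℕ → ℕ → ℂ} (hf : EndSummable f) (hg : Moderate g) :
    EndSummable (f * g) := by
  obtain ⟨⟨s, hs, hb⟩, hl⟩ := hf
  exact ⟨⟨_, by linarith, hb.mul (hg.bound ((-(3 / 2) - s) / 2) (by linarith))⟩,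
    hl.mul hg.limits⟩

/-- The root of unity `e^{2πi/n}`. -/
noncomputable def rootExp (n : ℕ) : ℂ := Complex.exp (2 * Real.pi * Complex.I / n)

theorem rootExp_isPrimitiveRoot {n : ℕ} (hn : 0 < n) : IsPrimitiveRoot (rootExp n) n :=
  Complex.isPrimitiveRoot_exp n hn.ne'

theorem norm_rootExp (n : ℕ) : ‖rootExp n‖ = 1 := by
  have : 2 * Real.pi * Complex.I / n = ((2 * Real.pi / n : ℝ) : ℂ) * Complex.I := by
    push_cast; ring
  rw [rootExp, this, Complex.norm_exp_ofReal_mul_I]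

theorem rootExp_ne_zero (n : ℕ) : rootExp n ≠ 0 := Complex.exp_ne_zero _

theorem rootExp_pow_eq (n m : ℕ) :
    rootExp n ^ m = Complex.exp (Complex.I * (2 * Real.pi * m / n : ℝ)) := by
  rw [rootExp, ← Complex.exp_nat_mul]
  congr 1
  push_cast
  ring

theorem rootExp_pow_sub {n m : ℕ} (h : m < n) : rootExp n ^ (n - m) = (rootExp n ^ m)⁻¹ := by
  rw [pow_sub₀ _ (rootExp_ne_zero n) h.le, (rootExp_isPrimitiveRoot (by omega)).pow_eq_one,
    one_mul]

theorem rootExp_pow_ne_one {n m : ℕ} (h0 : 0 < m) (h : m < n) : rootExp n ^ m ≠ 1 :=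
  (rootExp_isPrimitiveRoot (by omega)).pow_ne_one_of_pos_of_lt h0.ne' h

theorem tendsto_two_pi_I_div :
    Tendsto (fun n : ℕ => 2 * Real.pi * Complex.I / (n : ℂ)) atTop (nhds 0) :=
  tendsto_const_div_atTop_nhds_zero_nat _

theorem tendsto_rootExp : Tendsto rootExp atTop (nhds 1) := by
  have := (Complex.continuous_exp.tendsto 0).comp tendsto_two_pi_I_div
  rwa [Complex.exp_zero] at this

theorem tendsto_mul_rootExp_sub_one :
    Tendsto (fun n : ℕ => (n : ℂ) * (rootExp n - 1)) atTop (nhds (2 * Real.pi * Complex.I)) := by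
  have h := hasDerivAt_iff_tendsto_slope_zero.1 (Complex.hasDerivAt_exp 0)
  have h2 : Tendsto (fun n : ℕ => 2 * Real.pi * Complex.I / (n : ℂ)) atTop
      (nhdsWithin 0 {0}ᶜ) := by
    refine tendsto_nhdsWithin_iff.2 ⟨tendsto_two_pi_I_div, ?_⟩
    filter_upwards [eventually_gt_atTop 0] with n hn
    have : (n : ℂ) ≠ 0 := by exact_mod_cast hn.ne'
    simp [Real.pi_ne_zero, this]
  have h3 := (h.comp h2).const_mul (2 * Real.pi * Complex.I)
  rw [Complex.exp_zero, mul_one] at h3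
  refine h3.congr' ?_
  filter_upwards [eventually_gt_atTop 0] with n hn
  have : (n : ℂ) ≠ 0 := by exact_mod_cast hn.ne'
  have h4 : (2 * Real.pi * Complex.I : ℂ) ≠ 0 := Complex.two_pi_I_ne_zero
  simp only [Function.comp, smul_eq_mul, zero_add, rootExp, inv_div]
  field_simp

/-- The family of inverse `q`-integers `1/[m]_q` at `q = e^{2πi/n}`. -/
noncomputable def invQint (n m : ℕ) : ℂ := (qint (rootExp n) m)⁻¹

theorem norm_one_sub_rootExp_le (n : ℕ) : ‖1 - rootExp n‖ ≤ 2 * Real.pi / n := by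
  have h := Real.norm_exp_I_mul_ofReal_sub_one_le (x := 2 * Real.pi * (1 : ℕ) / n)
  rw [← rootExp_pow_eq, pow_one, norm_sub_rev, Nat.cast_one, mul_one] at h
  rwa [Real.norm_of_nonneg (by positivity)] at h

theorem le_norm_one_sub_rootExp_pow {n m : ℕ} (h0 : 0 < m) (h : m < n) :
    4 * ((min m (n - m) : ℕ) : ℝ) / n ≤ ‖1 - rootExp n ^ m‖ := by
  have key : ∀ m : ℕ, 2 * m ≤ n → 4 * (m : ℝ) / n ≤ ‖1 - rootExp n ^ m‖ := by
    intro m hm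
    have hn : (0 : ℝ) < n := by exact_mod_cast (by omega : 0 < n)
    have hm : 2 * (m : ℝ) ≤ n := by exact_mod_cast hm
    rw [norm_sub_rev, rootExp_pow_eq, Complex.norm_exp_I_mul_ofReal_sub_one]
    have h1 := Real.mul_le_sin (x := 2 * Real.pi * m / n / 2) (by positivity) (by
      rw [div_div, div_le_div_iff₀ (by positivity) two_pos]
      nlinarith [Real.pi_pos])
    have h2 : 2 / Real.pi * (2 * Real.pi * m / n / 2) = 2 * m / n := by
      field_simp
    rw [h2] at h1
    refine le_trans ?_ (le_abs_self _)
    linear_combination 2 * h1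
  rcases le_total m (n - m) with h1 | h1
  · rw [min_eq_left h1]
    exact key m (by omega)
  · rw [min_eq_right h1]
    refine (key (n - m) (by omega)).trans_eq ?_
    have h2 : 1 - rootExp n ^ (n - m) = -((rootExp n ^ m)⁻¹ * (1 - rootExp n ^ m)) := by
      have := pow_ne_zero m (rootExp_ne_zero n)
      rw [rootExp_pow_sub h]
      field_simp
      ring
    rw [h2, norm_neg, norm_mul, norm_inv, norm_pow, norm_rootExp]
    simp

theorem endBounded_invQint : EndBounded (-1) invQint := by
  refine ⟨Real.pi / 2, by positivity, fun n m h0 h => ?_⟩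
  have h1 := le_norm_one_sub_rootExp_pow h0 h
  have h2 := norm_one_sub_rootExp_le n
  have h3 := one_le_min_sub h0 h
  have hn : (0 : ℝ) < n := by exact_mod_cast (by omega : 0 < n)
  rw [invQint, qint, inv_div, norm_div, Real.rpow_neg_one]
  calc _ ≤ (2 * Real.pi / n) / (4 * ((min m (n - m) : ℕ) : ℝ) / n) := by gcongr
    _ = _ := by field_simp; ring

theorem endLimits_invQint : EndLimits invQint := by
  have hlow : ∀ m, 0 < m → Tendsto (fun n => invQint n m) atTop (nhds (m : ℂ)⁻¹) := by
    intro m hm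
    have h : Tendsto (fun n => ∑ i ∈ Finset.range m, rootExp n ^ i) atTop (nhds (m : ℂ)) := by
      have := tendsto_finsetSum (Finset.range m) fun i _ => tendsto_rootExp.pow i
      simpa using this
    refine (h.inv₀ (by exact_mod_cast hm.ne')).congr' ?_
    filter_upwards [eventually_gt_atTop 1] with n hn
    have h1 := rootExp_pow_ne_one one_pos hn
    rw [pow_one] at h1
    rw [invQint, qint, geom_sum_eq h1, ← neg_div_neg_eq, neg_sub, neg_sub]
  refine ⟨fun m hm => ⟨_, hlow m hm⟩, fun l hl => ⟨_, (((tendsto_rootExp.pow l).mul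
    (hlow l hl)).neg).congr' ?_⟩⟩
  filter_upwards [eventually_gt_atTop l] with n hn
  have h0 := pow_ne_zero l (rootExp_ne_zero n)
  have h1 : 1 - rootExp n ^ l ≠ 0 := sub_ne_zero.2 (rootExp_pow_ne_one hl hn).symm
  have h2 : 1 - (rootExp n ^ l)⁻¹ ≠ 0 := by
    rw [← rootExp_pow_sub hn]
    exact sub_ne_zero.2 (rootExp_pow_ne_one (by omega) (by omega)).symm
  rw [invQint, invQint, qint, qint, inv_div, inv_div, rootExp_pow_sub hn, eq_div_iff h2]
  field_simp
  ring

theorem partialSum_invQint_pred {n : ℕ} (hn : 0 < n) :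
    partialSum invQint n (n - 1) = (1 - rootExp n) * (n - 1) / 2 := by
  have h : ∑ m ∈ Finset.range (n - 1), (invQint n (m + 1) + invQint n (n - 1 - 1 - m + 1)) =
      ∑ m ∈ Finset.range (n - 1), (1 - rootExp n) := by
    refine Finset.sum_congr rfl fun m hm => ?_
    have hm := Finset.mem_range.1 hm
    have h0 := pow_ne_zero (m + 1) (rootExp_ne_zero n)
    have h1 : 1 - rootExp n ^ (m + 1) ≠ 0 :=
      sub_ne_zero.2 (rootExp_pow_ne_one (by omega) (by omega)).symm
    have h2 : 1 - (rootExp n ^ (m + 1))⁻¹ ≠ 0 := by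
      rw [← rootExp_pow_sub (by omega)]
      exact sub_ne_zero.2 (rootExp_pow_ne_one (by omega) (by omega)).symm
    rw [show n - 1 - 1 - m + 1 = n - (m + 1) by omega, invQint, invQint, qint, qint, inv_div,
      inv_div, rootExp_pow_sub (by omega), div_add_div _ _ h1 h2, div_eq_iff (mul_ne_zero h1 h2)]
    field_simp
    ring
  rw [Finset.sum_add_distrib, Finset.sum_range_reflect (fun m => invQint n (m + 1))] at h
  simp only [Finset.sum_const, Finset.card_range, nsmul_eq_mul, Nat.cast_pred hn] at h
  rw [partialSum]
  linear_combination h / 2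

theorem sum_inv_succ_le {ε : ℝ} (hε : 0 < ε) (M : ℕ) :
    ∑ m ∈ Finset.range M, ((m + 1 : ℕ) : ℝ) ^ (-1 : ℝ) ≤ (1 + 1 / ε) * (M : ℝ) ^ ε := by
  rcases Nat.eq_zero_or_pos M with rfl | hM
  · simp only [Finset.range_zero, Finset.sum_empty]
    positivity
  have h1 : (1 : ℝ) ≤ M := by exact_mod_cast hM
  have h2 := harmonic_le_one_add_log M
  have h3 := Real.log_le_rpow_div (by positivity : (0 : ℝ) ≤ M) hε
  have h4 := Real.one_le_rpow h1 hε.le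
  calc _ = ((harmonic M : ℚ) : ℝ) := by simp [harmonic, Real.rpow_neg_one]
    _ ≤ 1 + Real.log M := h2
    _ ≤ (M : ℝ) ^ ε + (M : ℝ) ^ ε / ε := add_le_add h4 h3
    _ = _ := by ring

theorem moderate_partialSum_invQint : Moderate (partialSum invQint) := by
  refine ⟨fun ε hε => ?_, endLimits_invQint.partialSum ?_⟩
  · obtain ⟨C, hC, hb⟩ := endBounded_invQint
    refine ⟨Real.pi + C * (1 + 1 / ε), by positivity, fun n M h0 h1 => ?_⟩
    have hpi := Real.pi_pos
    rcases le_total M (n - M) with h | h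
    · rw [min_eq_left h]
      calc ‖partialSum invQint n M‖ ≤ ∑ m ∈ Finset.range M, ‖invQint n (m + 1)‖ := norm_sum_le _ _
        _ ≤ ∑ m ∈ Finset.range M, C * ((m + 1 : ℕ) : ℝ) ^ (-1 : ℝ) := by
          refine Finset.sum_le_sum fun m hm => ?_
          have hm := Finset.mem_range.1 hm
          have := hb n (m + 1) (by omega) (by omega)
          rwa [show min (m + 1) (n - (m + 1)) = m + 1 by omega] at this
        _ ≤ C * ((1 + 1 / ε) * (M : ℝ) ^ ε) := by
          rw [← Finset.mul_sum]
          exact mul_le_mul_of_nonneg_left (sum_inv_succ_le hε M) hC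
        _ ≤ _ := by
          rw [← mul_assoc]
          gcongr
          linarith
    · rw [min_eq_right h]
      have hn : (1 : ℝ) ≤ n := by exact_mod_cast (by omega : 1 ≤ n)
      have h2 : (1 : ℝ) ≤ (n - M : ℕ) := by exact_mod_cast (by omega : 1 ≤ n - M)
      have h3 := Real.one_le_rpow h2 hε.le
      have htot : ‖partialSum invQint n (n - 1)‖ ≤ Real.pi := by
        rw [partialSum_invQint_pred (by omega), norm_div, norm_mul]
        have h4 : ‖(n : ℂ) - 1‖ = n - 1 := by
          rw [show (n : ℂ) - 1 = ((n - 1 : ℝ) : ℂ) by push_cast; ring, Complex.norm_real,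
            Real.norm_of_nonneg (by linarith)]
        rw [h4, Complex.norm_ofNat, div_le_iff₀ two_pos]
        calc _ ≤ 2 * Real.pi / n * n := by
              gcongr
              · exact norm_one_sub_rootExp_le n
              · linarith
          _ = _ := by field_simp
      have hrest : ‖∑ j ∈ Finset.range (n - 1 - M), invQint n (n - (j + 1))‖ ≤
          C * ((1 + 1 / ε) * ((n - M : ℕ) : ℝ) ^ ε) := by
        calc _ ≤ ∑ j ∈ Finset.range (n - 1 - M), ‖invQint n (n - (j + 1))‖ := norm_sum_le _ _
          _ ≤ ∑ j ∈ Finset.range (n - 1 - M), C * ((j + 1 : ℕ) : ℝ) ^ (-1 : ℝ) := by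
            refine Finset.sum_le_sum fun m hm => ?_
            have hm := Finset.mem_range.1 hm
            have := hb n (n - (m + 1)) (by omega) (by omega)
            rwa [show min (n - (m + 1)) (n - (n - (m + 1))) = m + 1 by omega] at this
          _ ≤ C * ((1 + 1 / ε) * ((n - 1 - M : ℕ) : ℝ) ^ ε) := by
            rw [← Finset.mul_sum]
            exact mul_le_mul_of_nonneg_left (sum_inv_succ_le hε _) hC
          _ ≤ _ := by
            gcongr
            omega
      rw [← add_sub_cancel_right (partialSum invQint n M)
        (∑ j ∈ Finset.range (n - 1 - M), invQint n (n - (j + 1))), ← partialSum_pred _ h1]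
      calc _ ≤ _ := (norm_sub_le _ _).trans (add_le_add htot hrest)
        _ ≤ Real.pi * ((n - M : ℕ) : ℝ) ^ ε + C * ((1 + 1 / ε) * ((n - M : ℕ) : ℝ) ^ ε) := by
          gcongr
          exact le_mul_of_one_le_right hpi.le h3
        _ = _ := by ring
  · refine ⟨_, ((tendsto_rootExp.sub_const 1).sub tendsto_mul_rootExp_sub_one).div_const 2
      |>.congr' ?_⟩
    filter_upwards [eventually_gt_atTop 0] with n hn
    rw [partialSum_invQint_pred hn]
    ring

/-- The complete homogeneous sums of `1/[m]_q`, i.e. `z^⋆({1}^p)` truncated at `m ≤ M`. -/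
noncomputable def homogSum : ℕ → ℕ → ℕ → ℂ
  | 0 => 1
  | p + 1 => partialSum (invQint * homogSum p)

theorem homogSum_succ_succ (p n M : ℕ) :
    homogSum (p + 1) n (M + 1) =
      homogSum (p + 1) n M + invQint n (M + 1) * homogSum p n (M + 1) :=
  partialSum_succ _ _ _

/-- Newton's identity for complete homogeneous sums. -/
theorem natCast_mul_homogSum (n : ℕ) : ∀ p M : ℕ,
    (p : ℂ) * homogSum p n M =
      ∑ i ∈ Finset.range p, homogSum (p - 1 - i) n M * partialSum (invQint ^ (i + 1)) n M
  | 0, M => by simp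
  | p + 1, 0 => by simp [homogSum]
  | p + 1, M + 1 => by
    have ih1 := natCast_mul_homogSum n (p + 1) M
    have ih2 := natCast_mul_homogSum n p (M + 1)
    set x := invQint n (M + 1) with hx
    have hstep : ∀ i ∈ Finset.range p, homogSum (p - i) n (M + 1) =
        homogSum (p - i) n M + x * homogSum (p - 1 - i) n (M + 1) := by
      intro i hi
      have := Finset.mem_range.1 hi
      rw [show p - i = p - 1 - i + 1 by omega]
      exact homogSum_succ_succ _ _ _
    have hQ : ∀ i, partialSum (invQint ^ (i + 1)) n (M + 1) =
        partialSum (invQint ^ (i + 1)) n M + x ^ (i + 1) := fun i => partialSum_succ _ _ _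
    have e1 : ∑ i ∈ Finset.range p,
        homogSum (p - i) n (M + 1) * partialSum (invQint ^ (i + 1)) n M =
        ∑ i ∈ Finset.range p, homogSum (p - i) n M * partialSum (invQint ^ (i + 1)) n M +
        x * ∑ i ∈ Finset.range p,
          homogSum (p - 1 - i) n (M + 1) * partialSum (invQint ^ (i + 1)) n M := by
      rw [Finset.mul_sum, ← Finset.sum_add_distrib]
      refine Finset.sum_congr rfl fun i hi => ?_
      rw [hstep i hi]
      ring
    have e2 : ∑ i ∈ Finset.range (p + 1), homogSum (p - i) n (M + 1) * x ^ (i + 1) =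
        x * homogSum p n (M + 1) +
        x * ∑ i ∈ Finset.range p, homogSum (p - 1 - i) n (M + 1) * x ^ (i + 1) := by
      rw [Finset.sum_range_succ', add_comm, Finset.mul_sum]
      congr 1
      · simp [mul_comm]
      · refine Finset.sum_congr rfl fun i _ => ?_
        rw [show p - (i + 1) = p - 1 - i by omega]
        ring
    simp only [hQ, mul_add, Finset.sum_add_distrib] at ih2
    simp only [hQ, mul_add, Finset.sum_add_distrib, Nat.add_sub_cancel] at ih1 ⊢
    rw [e2, Finset.sum_range_succ, e1]
    rw [Finset.sum_range_succ] at ih1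
    simp only [Nat.sub_self, homogSum, Pi.one_apply, one_mul] at ih1 ⊢
    change _ * homogSum (p + 1) n M = _ at ih1
    change _ * homogSum (p + 1) n (M + 1) = _
    rw [homogSum_succ_succ]
    push_cast at ih1 ⊢
    linear_combination ih1 + x * ih2

theorem endSummable_invQint_pow {c : ℕ} (hc : 2 ≤ c) : EndSummable (invQint ^ c) := by
  refine ⟨⟨_, ?_, endBounded_invQint.pow c⟩, endLimits_invQint.pow c⟩
  have : (2 : ℝ) ≤ c := by exact_mod_cast hc
  linarith

theorem moderate_partialSum_invQint_pow : ∀ i : ℕ, Moderate (partialSum (invQint ^ (i + 1)))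
  | 0 => by simpa using moderate_partialSum_invQint
  | i + 1 => EndSummable.partialSum (endSummable_invQint_pow (by omega))

theorem moderate_homogSum (p : ℕ) : Moderate (homogSum p) := by
  induction p using Nat.strong_induction_on with
  | _ p ih =>
  cases p with
  | zero => exact Moderate.const 1
  | succ p =>
    have h := (Moderate.const ((p + 1 : ℕ) : ℂ)⁻¹).mul (Moderate.sum (Finset.range (p + 1))
      fun i _ => (ih (p + 1 - 1 - i) (by omega)).mul (moderate_partialSum_invQint_pow i))
    convert h using 1
    ext n M
    have hp : ((p + 1 : ℕ) : ℂ) ≠ 0 := by exact_mod_cast p.succ_ne_zero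
    simp only [Pi.mul_apply, Finset.sum_apply]
    rw [← natCast_mul_homogSum, inv_mul_cancel_left₀ hp]

/-- Families built from the truncated sums `homogSum` and absolutely convergent sums; this class
is stable under the summation operator `f ↦ partialSum (invQint * f)`. -/
inductive Regularizable : (ℕ → ℕ → ℂ) → Prop
  | homog (p : ℕ) : Regularizable (homogSum p)
  | mul (p : ℕ) {a : ℕ → ℕ → ℂ} (ha : EndSummable a) :
      Regularizable (homogSum p * partialSum a)
  | add {f g : ℕ → ℕ → ℂ} : Regularizable f → Regularizable g → Regularizable (f + g)
  | neg {f : ℕ → ℕ → ℂ} : Regularizable f → Regularizable (-f)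

theorem Regularizable.moderate {f : ℕ → ℕ → ℂ} (h : Regularizable f) : Moderate f := by
  induction h with
  | homog p => exact moderate_homogSum p
  | mul p ha => exact (moderate_homogSum p).mul ha.partialSum
  | add _ _ ihf ihg => exact ihf.add ihg
  | neg _ ih => exact ih.neg

theorem EndSummable.regularizable_partialSum {a : ℕ → ℕ → ℂ} (ha : EndSummable a) :
    Regularizable (_root_.partialSum a) := by
  simpa [homogSum] using Regularizable.mul 0 ha

theorem partialSum_invQint_mul_homogSum_mul (p : ℕ) (a : ℕ → ℕ → ℂ) :
    partialSum (invQint * (homogSum p * partialSum a)) =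
      homogSum (p + 1) * partialSum a +
        -partialSum (a * (homogSum (p + 1) + -(invQint * homogSum p))) := by
  ext n M
  induction M with
  | zero => simp [homogSum]
  | succ M ih =>
    simp only [Pi.add_apply, Pi.mul_apply, Pi.neg_apply] at ih ⊢
    rw [partialSum_succ, partialSum_succ a, partialSum_succ (a * _), ih]
    simp only [Pi.add_apply, Pi.mul_apply, Pi.neg_apply]
    rw [homogSum_succ_succ, partialSum_succ a]
    ring

theorem moderate_invQint : Moderate invQint :=
  ⟨fun _ h => endBounded_invQint.mono (by linarith), endLimits_invQint⟩

theorem Regularizable.partialSum_invQint_mul {f : ℕ → ℕ → ℂ} (h : Regularizable f) :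
    Regularizable (partialSum (invQint * f)) := by
  induction h with
  | homog p => exact .homog (p + 1)
  | mul p ha =>
    rw [partialSum_invQint_mul_homogSum_mul]
    exact .add (.mul (p + 1) ha) (.neg (ha.mul_moderate ((moderate_homogSum (p + 1)).add
      (moderate_invQint.mul (moderate_homogSum p)).neg)).regularizable_partialSum)
  | add _ _ ihf ihg => rw [mul_add, partialSum_add]; exact ihf.add ihg
  | neg _ ih => rw [mul_neg, partialSum_neg]; exact ih.neg

theorem moderate_rootExp_pow : Moderate (fun n m => rootExp n ^ m) := by
  refine ⟨fun ε hε => EndBounded.mono (s := 0) ⟨1, zero_le_one, fun n m _ _ => ?_⟩ hε.le,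
    fun m _ => ⟨_, tendsto_rootExp.pow m⟩,
    fun l _ => ⟨_, ((tendsto_rootExp.pow l).inv₀ (by simp)).congr' ?_⟩⟩
  · simp [norm_rootExp]
  · filter_upwards [eventually_gt_atTop l] with n hn
    rw [rootExp_pow_sub hn]

theorem Moderate.pow {f : ℕ → ℕ → ℂ} (hf : Moderate f) (p : ℕ) : Moderate (f ^ p) := by
  induction p with
  | zero => rw [pow_zero]; exact const 1
  | succ p ih => rw [pow_succ]; exact ih.mul hf

theorem regularizable_zqStar : ∀ {ks : List ℕ}, (∀ c ∈ ks, 0 < c) →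
    Regularizable (fun n M => zqStar (rootExp n) ks (M + 1))
  | [], _ => .homog 0
  | c :: ks, h => by
    have ih := regularizable_zqStar fun c hc => h c (List.mem_cons_of_mem _ hc)
    have hrec : (fun n M => zqStar (rootExp n) (c :: ks) (M + 1)) = partialSum
        (invQint ^ c * ((fun n m => rootExp n ^ m) ^ (c - 1) *
          fun n M => zqStar (rootExp n) ks (M + 1))) := by
      ext n M
      rw [zqStar, sum_Ioo_zero_succ]
      refine Finset.sum_congr rfl fun m _ => ?_
      simp only [Pi.mul_apply, Pi.pow_apply, invQint]
      rw [mul_comm (c - 1), pow_mul, inv_pow]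
      ring
    rw [hrec]
    obtain rfl | hc : c = 1 ∨ 2 ≤ c := by
      have := h c List.mem_cons_self
      omega
    · simpa using ih.partialSum_invQint_mul
    · exact ((endSummable_invQint_pow hc).mul_moderate
        ((moderate_rootExp_pow.pow _).mul ih.moderate)).regularizable_partialSum

theorem exists_tendsto_zqStar {ks : List ℕ} (h : ∀ c ∈ ks, 0 < c) :
    ∃ L, Tendsto (fun n => zqStar (rootExp n) ks n) atTop (nhds L) := by
  obtain ⟨L, hL⟩ := (regularizable_zqStar h).moderate.limits.high 1 one_pos
  refine ⟨L, hL.congr' ?_⟩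
  filter_upwards [eventually_gt_atTop 0] with n hn
  rw [Nat.sub_add_cancel hn]

theorem HoffmanDual.tendsto_zqStar {k k' : List ℕ} {L L' : ℂ} (h : HoffmanDual k k')
    (hL : Tendsto (fun n => zqStar (rootExp n) k n) atTop (nhds L))
    (hL' : Tendsto (fun n => zqStar (rootExp n) k' n) atTop (nhds L')) :
    L' = -(starRingEnd ℂ) L := by
  have h1 := (tendsto_rootExp.pow k.sum).mul ((Complex.continuous_conj.tendsto L').comp hL')
  have h2 := tendsto_nhds_unique (h1.congr' ?_) hL.neg
  · rw [one_pow, one_mul] at h2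
    rw [← map_neg, ← h2, Complex.conj_conj]
  · filter_upwards [eventually_gt_atTop 0] with n hn
    rw [Function.comp_apply, zqStar_conj, ← Complex.inv_eq_conj (norm_rootExp n)]
    exact h.zqStar_inv hn (rootExp_isPrimitiveRoot hn).pow_eq_one fun m => rootExp_pow_ne_one

/-- For `k = [a_1,…,a_r;b_1,…,b_r]` with Hoffman dual
`k^∨ = reverse [b_r,…,b_1;a_r,…,a_1]`, the limits `ξ^⋆(k) = lim_n z_n^⋆(k; e^{2πi/n})`
and `ξ^⋆(k^∨)` exist and `ξ^⋆(k^∨) = -conj(ξ^⋆(k))`. -/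
theorem stmt_15 (a b : List ℕ) (ha : a ≠ []) (hlen : a.length = b.length)
    (hapos : ∀ i ∈ a, 0 < i) (hbpos : ∀ i ∈ b, 0 < i) :
    ∃ L L' : ℂ,
      Tendsto (fun n : ℕ =>
          zqStar (Complex.exp (2 * Real.pi * Complex.I / n)) (abIndex a b) n)
        atTop (nhds L) ∧
      Tendsto (fun n : ℕ =>
          zqStar (Complex.exp (2 * Real.pi * Complex.I / n))
            ((abIndex b.reverse a.reverse).reverse) n)
        atTop (nhds L') ∧
      L' = -(starRingEnd ℂ) L := by
  have h := hoffmanDual_abIndex ha hlen hapos hbpos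
  obtain ⟨L, hL⟩ := exists_tendsto_zqStar h.pos
  obtain ⟨L', hL'⟩ := exists_tendsto_zqStar h.symm.pos
  exact ⟨L, L', hL, hL', h.tendsto_zqStar hL hL'⟩
end

section
/- There exists an integer N such that for every prime p > N, the congruence 2·∑_{p>m_1≥m_2>0} 1/(m_1⁴ m_2) + ∑_{p>m_1≥m_2>0} 1/(m_1³ m_2²) ≡ 0 (mod p) holds; that is, in 𝔽_p one has 2·∑_{p>m_1≥m_2>0} (m_1)^{−4}(m_2)^{−1} + ∑_{p>m_1≥m_2>0} (m_1)^{−3}(m_2)^{−2} = 0, where the sums are over integers p > m_1 ≥ m_2 > 0 and inverses are taken in 𝔽_p. -/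
/-- The truncated multiple harmonic star sum
`∑_{n > m_1 ≥ ⋯ ≥ m_r > 0} ∏_j (m_j mod p)^{-k_j}` in `𝔽_p = ZMod p`. -/
def mhsStar (p : ℕ) : List ℕ → ℕ → ZMod p
  | [], _ => 1
  | k :: ks, n => ∑ m ∈ Finset.Ioo 0 n, ((m : ZMod p)⁻¹) ^ k * mhsStar p ks (m + 1)

/-- The truncated double harmonic sum `∑_{p > m > i > 0} m⁻ᵃ i⁻ᵇ` in `ZMod p`. -/
def doubleHarmonicSum (p a b : ℕ) : ZMod p :=
  ∑ m ∈ Finset.Ioo 0 p, ∑ i ∈ Finset.Ioo 0 m, ((m : ZMod p)⁻¹) ^ a * ((i : ZMod p)⁻¹) ^ b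

theorem mhsStar_pair (p a b : ℕ) :
    mhsStar p [a, b] p =
      doubleHarmonicSum p a b + ∑ m ∈ Finset.Ioo 0 p, ((m : ZMod p)⁻¹) ^ (a + b) := by
  simp only [mhsStar, doubleHarmonicSum, mul_one]
  rw [← Finset.sum_add_distrib]
  refine Finset.sum_congr rfl fun m hm => ?_
  have hins : Finset.Ioo 0 (m + 1) = insert m (Finset.Ioo 0 m) := by
    ext x
    simp only [Finset.mem_Ioo, Finset.mem_insert] at hm ⊢
    omega
  rw [hins, Finset.sum_insert (by simp), ← Finset.mul_sum]
  ring

theorem natCast_self_sub {p m : ℕ} (h : m ≤ p) : ((p - m : ℕ) : ZMod p) = -(m : ZMod p) := by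
  simp [Nat.cast_sub h]

theorem sum_Ioo_reflect {M : Type*} [AddCommMonoid M] (a b : ℕ) (f : ℕ → M) :
    ∑ m ∈ Finset.Ioo a b, f m = ∑ m ∈ Finset.Ioo a b, f (a + b - m) := by
  refine Finset.sum_nbij' (fun m => a + b - m) (fun m => a + b - m) ?_ ?_ ?_ ?_ ?_ <;>
    intro m hm <;> simp only [Finset.mem_Ioo] at hm ⊢
  · omega
  · omega
  · omega
  · omega
  · congr 1
    omega

theorem sum_Ioo_comm {M : Type*} [AddCommMonoid M] (n : ℕ) (f : ℕ → ℕ → M) :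
    ∑ m ∈ Finset.Ioo 0 n, ∑ i ∈ Finset.Ioo 0 m, f m i =
      ∑ i ∈ Finset.Ioo 0 n, ∑ m ∈ Finset.Ioo i n, f m i :=
  Finset.sum_comm' fun m i => by simp only [Finset.mem_Ioo]; omega

/-- Odd power sums of inverses are antisymmetric under `m ↦ p - m`. -/
theorem sum_inv_pow_eq_neg {p k : ℕ} [Fact p.Prime] (hk : Odd k) :
    ∑ m ∈ Finset.Ioo 0 p, ((m : ZMod p)⁻¹) ^ k =
      -∑ m ∈ Finset.Ioo 0 p, ((m : ZMod p)⁻¹) ^ k := by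
  conv_lhs => rw [sum_Ioo_reflect]
  rw [← Finset.sum_neg_distrib]
  refine Finset.sum_congr rfl fun m hm => ?_
  rw [zero_add, natCast_self_sub (Finset.mem_Ioo.1 hm).2.le, inv_neg, hk.neg_pow]

theorem doubleHarmonicSum_reverse {p : ℕ} [Fact p.Prime] (a b : ℕ) :
    doubleHarmonicSum p a b = (-1) ^ (a + b) * doubleHarmonicSum p b a := by
  unfold doubleHarmonicSum
  rw [sum_Ioo_comm p (fun m i => ((m : ZMod p)⁻¹) ^ a * ((i : ZMod p)⁻¹) ^ b),
    sum_Ioo_reflect, Finset.mul_sum]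
  refine Finset.sum_congr rfl fun m hm => ?_
  rw [Finset.mem_Ioo] at hm
  rw [Finset.mul_sum]
  refine Finset.sum_nbij' (fun i => p - i) (fun i => p - i) ?_ ?_ ?_ ?_ ?_ <;>
    intro i hi <;> simp only [Finset.mem_Ioo] at hi ⊢
  · omega
  · omega
  · omega
  · omega
  · rw [zero_add, natCast_self_sub hm.2.le, natCast_self_sub hi.2.le, inv_neg, inv_neg,
      neg_pow (m : ZMod p)⁻¹, neg_pow (i : ZMod p)⁻¹ a, pow_add]
    have h : ((-1 : ZMod p) ^ a) * (-1) ^ a = 1 := by rw [← mul_pow]; simp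
    linear_combination (-((-1 : ZMod p) ^ b) * ((m : ZMod p)⁻¹) ^ b * ((i : ZMod p)⁻¹) ^ a) * h

/-- The sum of `i⁻ᵃ j⁻ᵇ` over `i, j > 0` with `i + j < p`. -/
theorem sum_inv_pow_mul_inv_sub_pow {p : ℕ} [Fact p.Prime] (a b : ℕ) :
    ∑ m ∈ Finset.Ioo 0 p, ∑ i ∈ Finset.Ioo 0 m,
        ((i : ZMod p)⁻¹) ^ a * (((m - i : ℕ) : ZMod p)⁻¹) ^ b =
      (-1) ^ b * doubleHarmonicSum p b a := by
  unfold doubleHarmonicSum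
  rw [sum_Ioo_comm, sum_Ioo_comm, Finset.mul_sum]
  refine Finset.sum_congr rfl fun i _ => ?_
  rw [sum_Ioo_reflect, Finset.mul_sum]
  refine Finset.sum_congr rfl fun m hm => ?_
  rw [Finset.mem_Ioo] at hm
  rw [show i + p - m - i = p - m by omega, natCast_self_sub hm.2.le, inv_neg,
    neg_pow (m : ZMod p)⁻¹]
  ring

theorem partial_fraction_two_three {K : Type*} [Field K] {x y : K} (hx : x ≠ 0) (hy : y ≠ 0)
    (hxy : x + y ≠ 0) :
    x⁻¹ ^ 2 * y⁻¹ ^ 3 =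
      (x + y)⁻¹ ^ 2 * y⁻¹ ^ 3 + 2 * ((x + y)⁻¹ ^ 3 * y⁻¹ ^ 2) + 3 * ((x + y)⁻¹ ^ 4 * y⁻¹ ^ 1) +
        ((x + y)⁻¹ ^ 3 * x⁻¹ ^ 2 + 3 * ((x + y)⁻¹ ^ 4 * x⁻¹ ^ 1)) := by
  field_simp
  ring

theorem natCast_ne_zero_of_lt {p m : ℕ} (h0 : 0 < m) (h : m < p) : (m : ZMod p) ≠ 0 := by
  rw [Ne, ZMod.natCast_eq_zero_iff]
  exact Nat.not_dvd_of_pos_of_lt h0 h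

theorem doubleHarmonicSum_sub (p a b : ℕ) :
    ∑ m ∈ Finset.Ioo 0 p, ∑ i ∈ Finset.Ioo 0 m,
        ((m : ZMod p)⁻¹) ^ a * (((m - i : ℕ) : ZMod p)⁻¹) ^ b =
      doubleHarmonicSum p a b := by
  refine Finset.sum_congr rfl fun m _ => ?_
  conv_rhs => rw [sum_Ioo_reflect]
  simp only [zero_add]

/-- The shuffle relation for the product of indices `2` and `3`. -/
theorem doubleHarmonicSum_shuffle {p : ℕ} [Fact p.Prime] :
    -doubleHarmonicSum p 3 2 =
      doubleHarmonicSum p 2 3 + 3 * doubleHarmonicSum p 3 2 + 6 * doubleHarmonicSum p 4 1 := by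
  have key : ∑ m ∈ Finset.Ioo 0 p, ∑ i ∈ Finset.Ioo 0 m,
        ((i : ZMod p)⁻¹) ^ 2 * (((m - i : ℕ) : ZMod p)⁻¹) ^ 3 =
      doubleHarmonicSum p 2 3 + 2 * doubleHarmonicSum p 3 2 + 3 * doubleHarmonicSum p 4 1 +
        (doubleHarmonicSum p 3 2 + 3 * doubleHarmonicSum p 4 1) := by
    conv_rhs =>
      enter [1]
      rw [← doubleHarmonicSum_sub p 2 3, ← doubleHarmonicSum_sub p 3 2,
        ← doubleHarmonicSum_sub p 4 1]
    simp only [doubleHarmonicSum, Finset.mul_sum, ← Finset.sum_add_distrib]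
    refine Finset.sum_congr rfl fun m hm => Finset.sum_congr rfl fun i hi => ?_
    rw [Finset.mem_Ioo] at hm hi
    have hsum : (i : ZMod p) + ((m - i : ℕ) : ZMod p) = m := by
      rw [← Nat.cast_add, Nat.add_sub_cancel' hi.2.le]
    have h := partial_fraction_two_three (x := (i : ZMod p)) (y := ((m - i : ℕ) : ZMod p))
      (natCast_ne_zero_of_lt hi.1 (hi.2.trans hm.2))
      (natCast_ne_zero_of_lt (by omega) (by omega))
      (hsum ▸ natCast_ne_zero_of_lt hm.1 hm.2)
    rwa [hsum] at h
  rw [sum_inv_pow_mul_inv_sub_pow] at key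
  linear_combination key

/-- For all sufficiently large primes `p`, in `𝔽_p`:
`2·∑_{p>m_1≥m_2>0} m_1⁻⁴ m_2⁻¹ + ∑_{p>m_1≥m_2>0} m_1⁻³ m_2⁻² = 0`,
i.e. `2·ζ_𝒜^⋆(4,1) + ζ_𝒜^⋆(3,2) = 0`. -/
theorem stmt_17 :
    ∃ N : ℕ, ∀ p : ℕ, p.Prime → N < p →
      2 * mhsStar p [4, 1] p + mhsStar p [3, 2] p = 0 := by
  refine ⟨3, fun p hp h3 => ?_⟩
  have : Fact p.Prime := ⟨hp⟩
  have three_ne : (3 : ZMod p) ≠ 0 := by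
    exact_mod_cast natCast_ne_zero_of_lt (p := p) (m := 3) (by omega) h3
  have two_ne : (2 : ZMod p) ≠ 0 := by
    exact_mod_cast natCast_ne_zero_of_lt (p := p) (m := 2) (by omega) (by omega)
  have hpow : ∑ m ∈ Finset.Ioo 0 p, ((m : ZMod p)⁻¹) ^ 5 = 0 := by
    have h := sum_inv_pow_eq_neg (p := p) (k := 5) (by decide)
    refine (mul_eq_zero.1 ?_).resolve_left two_ne
    linear_combination h
  have hrev := doubleHarmonicSum_reverse (p := p) 2 3
  have hsh := doubleHarmonicSum_shuffle (p := p)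
  rw [mhsStar_pair, mhsStar_pair, hpow]
  refine (mul_eq_zero.1 ?_).resolve_left three_ne
  linear_combination -hsh - hrev
end

section
/- Let n ≥ 1 be an integer and q a complex number with q^m ≠ 1 for all 0 < m < n. For every index k = (k_1,…,k_r), the stuffle-type product formula z_n(1;q)·z_n(k_1,…,k_r;q) = ∑_{a=0}^{r} z_n(k_1,…,k_a,1,k_{a+1},…,k_r;q) + ∑_{a=1}^{r} z_n(k_1,…,k_{a−1},k_a+1,k_{a+1},…,k_r;q) + (1−q)·r·z_n(k_1,…,k_r;q) holds, where in the first sum the entry 1 is inserted after position a (at the front for a = 0, at the end for a = r). -/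
theorem sum_Ioo_mul_sum_Ioo {R : Type*} [CommRing R] (f g : ℕ → R) (n : ℕ) :
    (∑ m ∈ Finset.Ioo 0 n, f m) * ∑ m ∈ Finset.Ioo 0 n, g m =
      (∑ m ∈ Finset.Ioo 0 n, f m * ∑ l ∈ Finset.Ioo 0 m, g l) +
      (∑ m ∈ Finset.Ioo 0 n, g m * ∑ l ∈ Finset.Ioo 0 m, f l) +
      ∑ m ∈ Finset.Ioo 0 n, f m * g m := by
  induction n with
  | zero => simp
  | succ n ih =>
    rcases Nat.eq_zero_or_pos n with rfl | hn
    · simp [show Finset.Ioo 0 1 = (∅ : Finset ℕ) from rfl]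
    · have h : Finset.Ioo 0 (n + 1) = insert n (Finset.Ioo 0 n) := by
        ext m
        simp only [Finset.mem_Ioo, Finset.mem_insert]
        omega
      have hmem : n ∉ Finset.Ioo 0 n := by simp
      simp only [h, Finset.sum_insert hmem]
      linear_combination ih

theorem one_div_qint_mul (q : ℂ) (m k : ℕ) (hq : q ^ m ≠ 1) (hk : 0 < k) :
    q ^ ((1 - 1) * m) / qint q m ^ 1 * (q ^ ((k - 1) * m) / qint q m ^ k) =
      q ^ ((k + 1 - 1) * m) / qint q m ^ (k + 1) +
      (1 - q) * (q ^ ((k - 1) * m) / qint q m ^ k) := by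
  obtain ⟨k, rfl⟩ := Nat.exists_eq_succ_of_ne_zero hk.ne'
  have h1 : 1 - q ≠ 0 := by
    intro h
    exact hq (by rw [← sub_eq_zero.mp h, one_pow])
  have hm' : 1 - q ^ m ≠ 0 := sub_ne_zero.mpr hq.symm
  have h0 : qint q m ≠ 0 := div_ne_zero hm' h1
  have h : (1 - q) * qint q m = 1 - q ^ m := mul_div_cancel₀ _ h1
  simp only [Nat.succ_eq_add_one, Nat.add_sub_cancel, Nat.sub_self, zero_mul, pow_zero, add_mul,
    one_mul, pow_add, pow_one]
  field_simp
  linear_combination -q ^ (k * m) * h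

theorem zq_one_mul (q : ℂ) (k : List ℕ) (hk : ∀ i ∈ k, 0 < i) (n : ℕ)
    (hq : ∀ m : ℕ, 0 < m → m < n → q ^ m ≠ 1) :
    zq q [1] n * zq q k n =
      (∑ a ∈ Finset.range (k.length + 1), zq q (k.take a ++ 1 :: k.drop a) n) +
      (∑ a ∈ Finset.range k.length,
        zq q (k.take a ++ (k.getD a 0 + 1) :: k.drop (a + 1)) n) +
      (1 - q) * k.length * zq q k n := by
  induction k generalizing n with
  | nil => simp [zq]
  | cons k ks ih =>
    have hdiag : ∑ m ∈ Finset.Ioo 0 n, q ^ ((1 - 1) * m) / qint q m ^ 1 *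
        (q ^ ((k - 1) * m) / qint q m ^ k * zq q ks m) =
        zq q ((k + 1) :: ks) n + (1 - q) * zq q (k :: ks) n := by
      simp only [zq]
      rw [Finset.mul_sum, ← Finset.sum_add_distrib]
      refine Finset.sum_congr rfl fun m hm => ?_
      rw [Finset.mem_Ioo] at hm
      linear_combination zq q ks m *
        one_div_qint_mul q m k (hq m hm.1 hm.2) (hk k List.mem_cons_self)
    have hlow : ∑ m ∈ Finset.Ioo 0 n, (q ^ ((k - 1) * m) / qint q m ^ k * zq q ks m) *
        zq q [1] m =
        (∑ a ∈ Finset.range (ks.length + 1), zq q (k :: (ks.take a ++ 1 :: ks.drop a)) n) +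
        (∑ a ∈ Finset.range ks.length,
          zq q (k :: (ks.take a ++ (ks.getD a 0 + 1) :: ks.drop (a + 1))) n) +
        (1 - q) * ks.length * zq q (k :: ks) n := by
      simp only [zq.eq_2 q n k]
      rw [Finset.sum_comm, Finset.sum_comm (s := Finset.range ks.length), Finset.mul_sum,
        ← Finset.sum_add_distrib, ← Finset.sum_add_distrib]
      refine Finset.sum_congr rfl fun m hm => ?_
      rw [Finset.mem_Ioo] at hm
      rw [← Finset.mul_sum, ← Finset.mul_sum]
      linear_combination q ^ ((k - 1) * m) / qint q m ^ k *
        ih (fun i hi => hk i (List.mem_cons_of_mem _ hi)) m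
          fun l hl hlm => hq l hl (hlm.trans hm.2)
    have hprod : zq q [1] n * zq q (k :: ks) n = zq q (1 :: k :: ks) n +
        (∑ m ∈ Finset.Ioo 0 n, (q ^ ((k - 1) * m) / qint q m ^ k * zq q ks m) * zq q [1] m) +
        ∑ m ∈ Finset.Ioo 0 n, q ^ ((1 - 1) * m) / qint q m ^ 1 *
          (q ^ ((k - 1) * m) / qint q m ^ k * zq q ks m) := by
      simp only [zq, mul_one]
      exact sum_Ioo_mul_sum_Ioo _ _ n
    rw [hprod, hlow, hdiag, List.length_cons,
      Finset.sum_range_succ' (fun a => zq q ((k :: ks).take a ++ 1 :: (k :: ks).drop a) n),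
      Finset.sum_range_succ' (fun a =>
        zq q ((k :: ks).take a ++ ((k :: ks).getD a 0 + 1) :: (k :: ks).drop (a + 1)) n)]
    simp only [List.take_succ_cons, List.drop_succ_cons, List.take_zero, List.drop_zero,
      List.cons_append, List.nil_append, List.getD_cons_succ, List.getD_cons_zero]
    push_cast
    ring

/-- The stuffle-type product formula: for `q^m ≠ 1` (`0 < m < n`) and an index
`k = (k_1,…,k_r)`,
`z_n(1;q)·z_n(k;q) = ∑_{a=0}^r z_n(k_1,…,k_a,1,k_{a+1},…,k_r;q)
 + ∑_{a=1}^r z_n(k_1,…,k_a+1,…,k_r;q) + (1-q)·r·z_n(k;q)`. -/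
theorem stmt_19 (n : ℕ) (hn : 1 ≤ n) (q : ℂ)
    (hq : ∀ m : ℕ, 0 < m → m < n → q ^ m ≠ 1)
    (k : List ℕ) (hk : ∀ i ∈ k, 0 < i) :
    zq q [1] n * zq q k n =
      (∑ a ∈ Finset.range (k.length + 1), zq q (k.take a ++ 1 :: k.drop a) n) +
      (∑ a ∈ Finset.range k.length,
        zq q (k.take a ++ (k.getD a 0 + 1) :: k.drop (a + 1)) n) +
      (1 - q) * k.length * zq q k n := by
  exact zq_one_mul q k hk n hq
end
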